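/- arXiv:astro-ph/0501541 — 3 statements merged into one kernel-verified Lean document; each statement's English description precedes it below -/
import Mathlib

section
/- Let f₀ ∈ F_M be a minimizer of the energy-Casimir functional H_C, with induced potential U₀(x) = -∫∫ f₀(y,v)/|x-y| dv dy and particle energy E(x,v) = (1/2)|v|² + U₀(x). Then there exists a Lagrange multiplier E₀ ∈ ℝ such that for almost every (x,v) ∈ ℝ⁶: if E(x,v) < E₀ then f₀(x,v) > 0 and Φ'(f₀(x,v)) = E₀ - E(x,v) (i.e. f₀(x,v) = (Φ')⁻¹(E₀ - E(x,v))), and if E(x,v) ≥ E₀ then f₀(x,v) = 0. -/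
open MeasureTheory Filter Topology Set ENNReal

noncomputable section

/-- Physical space `ℝ³`. -/
abbrev R3 : Type := EuclideanSpace ℝ (Fin 3)

/-- Spatial density `ρ_f(x) = ∫ f(x,v) dv` induced by a phase-space density. -/
def spatialDensity (f : R3 × R3 → ℝ) (x : R3) : ℝ := ∫ v, f (x, v)

/-- Kinetic energy `E_kin(f) = (1/2)∫∫ |v|² f dv dx`. -/
def Ekin (f : R3 × R3 → ℝ) : ℝ := (1/2) * ∫ p : R3 × R3, ‖p.2‖ ^ 2 * f p

/-- `D(σ) = ∫∫ σ(x)σ(y)/|x-y| dx dy`. -/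
def Dpair (σ : R3 → ℝ) : ℝ := ∫ x, ∫ y, σ x * σ y / ‖x - y‖

/-- Potential energy `E_pot(ρ) = -(1/2)∫∫ ρ(x)ρ(y)/|x-y| dx dy`. -/
def Epot (ρ : R3 → ℝ) : ℝ := -(1/2) * Dpair ρ

/-- Casimir functional `C(f) = ∫∫ Φ(f) dv dx`. -/
def Casimir (Φ : ℝ → ℝ) (f : R3 × R3 → ℝ) : ℝ := ∫ p, Φ (f p)

/-- Energy-Casimir functional `H_C = E_kin + E_pot + C`. -/
def HC (Φ : ℝ → ℝ) (f : R3 × R3 → ℝ) : ℝ :=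
  Ekin f + Epot (spatialDensity f) + Casimir Φ f

/-- Membership in the constraint set `F_M`. -/
structure MemFM (Φ : ℝ → ℝ) (M : ℝ) (f : R3 × R3 → ℝ) : Prop where
  nonneg : ∀ p, 0 ≤ f p
  integrable : Integrable f
  mass : (∫ p, f p) = M
  kin_int : Integrable (fun p : R3 × R3 => ‖p.2‖ ^ 2 * f p)
  cas_int : Integrable (fun p => Φ (f p))

/-- The constraint set `F_M`. -/
def FMset (Φ : ℝ → ℝ) (M : ℝ) : Set ((R3 × R3) → ℝ) := {f | MemFM Φ M f}

/-- Hypotheses (Φ1)-(Φ3) on the Casimir function `Φ`, with derivative `Φ'`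
and growth exponents `k`, `k'`. -/
structure IsPhi (Φ Φ' : ℝ → ℝ) (k k' : ℝ) : Prop where
  zero : Φ 0 = 0
  deriv_zero : Φ' 0 = 0
  hasDeriv : ∀ s ∈ Ici (0:ℝ), HasDerivAt Φ (Φ' s) s
  derivCont : ContinuousOn Φ' (Ici 0)
  nonneg : ∀ s ∈ Ici (0:ℝ), 0 ≤ Φ s
  sconvex : StrictConvexOn ℝ (Ici 0) Φ
  k_pos : 0 < k
  k_lt : k < 3/2
  k'_pos : 0 < k'
  k'_lt : k' < 3/2
  growth_large : ∃ C > 0, ∃ F₁ > 0, ∀ s, F₁ ≤ s → C * s ^ (1 + 1/k) ≤ Φ s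
  growth_small : ∃ C > 0, ∃ F₂ > 0, ∀ s, 0 ≤ s → s ≤ F₂ → Φ s ≤ C * s ^ (1 + 1/k')

/-- Potential `U_ρ(x) = -∫ ρ(y)/|x-y| dy` induced by a spatial density. -/
def U0rho (ρ : R3 → ℝ) (x : R3) : ℝ := -∫ y, ρ y / ‖x - y‖

/-- Particle energy `E(x,v) = (1/2)|v|² + U₀(x)` for the state `f₀`. -/
def Epart (f₀ : R3 × R3 → ℝ) (p : R3 × R3) : ℝ :=
  (1/2) * ‖p.2‖ ^ 2 + U0rho (spatialDensity f₀) p.1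

/-- Reduced density function `Ψ(s)`, obtained from `Φ` by minimizing the sum of kinetic
energy density and Casimir density over all velocity profiles of total mass `s`. -/
def PsiOf (Φ : ℝ → ℝ) (s : ℝ) : ℝ :=
  sInf { r : ℝ | ∃ g : R3 → ℝ, (∀ v, 0 ≤ g v) ∧ Integrable g ∧ (∫ v, g v) = s ∧
    Integrable (fun v => (1/2) * ‖v‖ ^ 2 * g v + Φ (g v)) ∧
    r = ∫ v, ((1/2) * ‖v‖ ^ 2 * g v + Φ (g v)) }

/-- Reduced functional `H_r(ρ) = ∫ Ψ(ρ) dx + E_pot(ρ)`. -/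
def Hr (Ψ : ℝ → ℝ) (ρ : R3 → ℝ) : ℝ := (∫ x, Ψ (ρ x)) + Epot ρ

/-- Membership in the reduced constraint set `R_M`. -/
structure MemRM (Ψ : ℝ → ℝ) (M : ℝ) (ρ : R3 → ℝ) : Prop where
  nonneg : ∀ x, 0 ≤ ρ x
  integrable : Integrable ρ
  mass : (∫ x, ρ x) = M
  psi_int : Integrable (fun x => Ψ (ρ x))

/-- The reduced constraint set `R_M`. -/
def RMset (Ψ : ℝ → ℝ) (M : ℝ) : Set (R3 → ℝ) := {ρ | MemRM Ψ M ρ}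

/-- Hypotheses (Ψ1)-(Ψ3) on `Ψ`, with derivative `Ψ'` and growth exponents `n`, `n'`. -/
structure IsPsi (Ψ Ψ' : ℝ → ℝ) (n n' : ℝ) : Prop where
  zero : Ψ 0 = 0
  deriv_zero : Ψ' 0 = 0
  hasDeriv : ∀ s ∈ Ici (0:ℝ), HasDerivAt Ψ (Ψ' s) s
  derivCont : ContinuousOn Ψ' (Ici 0)
  nonneg : ∀ s ∈ Ici (0:ℝ), 0 ≤ Ψ s
  sconvex : StrictConvexOn ℝ (Ici 0) Ψ
  n_pos : 0 < n
  n_lt : n < 3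
  n'_pos : 0 < n'
  n'_lt : n' < 3
  growth_large : ∃ C > 0, ∃ s₁ > 0, ∀ s, s₁ ≤ s → C * s ^ (1 + 1/n) ≤ Ψ s
  growth_small : ∃ C > 0, ∃ s₂ > 0, ∀ s, 0 ≤ s → s ≤ s₂ → Ψ s ≤ C * s ^ (1 + 1/n')

/-- Relative "distance" `d(f,f₀) = ∫∫ [Φ(f) - Φ(f₀) + E (f - f₀)] dv dx`. -/
def dVP (Φ : ℝ → ℝ) (f₀ f : R3 × R3 → ℝ) : ℝ :=
  ∫ p, (Φ (f p) - Φ (f₀ p) + Epart f₀ p * (f p - f₀ p))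


/-! ### Part A: integrability of the interaction energy density -/

/-- The truncated squared Newton kernel. -/
def K1sq (x : R3) : ℝ := if ‖x‖ < 1 then (‖x‖ ^ 2)⁻¹ else 0

lemma K1sq_nonneg (x : R3) : 0 ≤ K1sq x := by
  unfold K1sq; split_ifs <;> positivity

lemma K1sq_meas : Measurable K1sq := by
  unfold K1sq
  exact Measurable.ite (measurableSet_lt measurable_norm measurable_const)
    (by fun_prop) measurable_const

lemma K1sq_integrable : Integrable K1sq := by
  have h := (integrable_fun_norm_addHaar (E := R3) (volume : Measure R3)
    (f := fun r : ℝ => if r < 1 then (r ^ 2)⁻¹ else 0)).2 ?_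
  · exact h
  · have h1 : IntegrableOn (Set.indicator (Iio (1:ℝ)) (fun _ => (1:ℝ))) (Ioi (0:ℝ)) := by
      rw [IntegrableOn, integrable_indicator_iff measurableSet_Iio, IntegrableOn,
        Measure.restrict_restrict measurableSet_Iio]
      have : Iio (1:ℝ) ∩ Ioi 0 = Ioo 0 1 := by ext x; simp [and_comm]
      rw [this]
      exact integrable_const _
    refine h1.congr_fun ?_ measurableSet_Ioi
    intro y hy
    have hy : (0:ℝ) < y := hy
    simp only [indicator, mem_Iio, finrank_euclideanSpace, Fintype.card_fin, smul_eq_mul]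
    split_ifs
    · norm_num
      field_simp
    · simp

lemma cross_integrable (h : R3 × R3 → ℝ) (hh : Integrable h) (W : R3 → ℝ) (hW : Integrable W) :
    Integrable (fun z : (R3 × R3) × (R3 × R3) => h z.1 * (K1sq (z.1.1 - z.2.1) * W z.2.2)) := by
  have hint : ∀ p : R3 × R3, Integrable (fun q : R3 × R3 => K1sq (p.1 - q.1) * W q.2) := by
    intro p
    exact (K1sq_integrable.comp_sub_left p.1).mul_prod hW
  have hms : AEStronglyMeasurable
      (fun z : (R3 × R3) × (R3 × R3) => h z.1 * (K1sq (z.1.1 - z.2.1) * W z.2.2)) := by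
    refine (hh.aestronglyMeasurable.comp_fst).mul (AEStronglyMeasurable.mul ?_ ?_)
    · exact (K1sq_meas.comp (by fun_prop)).aestronglyMeasurable
    · exact (hW.aestronglyMeasurable.comp_snd (μ := (volume : Measure R3))).comp_snd
        (μ := (volume : Measure (R3 × R3)))
  refine (integrable_prod_iff hms).2 ⟨Eventually.of_forall fun p => (hint p).const_mul (h p), ?_⟩
  have : (fun p : R3 × R3 => ∫ q : R3 × R3, ‖h p * (K1sq (p.1 - q.1) * W q.2)‖) =
      fun p => ‖h p‖ * ((∫ x, K1sq x) * ∫ v, ‖W v‖) := by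
    funext p
    simp only [norm_mul]
    rw [integral_const_mul]
    congr 1
    have := integral_prod_mul (μ := (volume : Measure R3)) (ν := (volume : Measure R3))
      (fun x => ‖K1sq (p.1 - x)‖) (fun v => ‖W v‖)
    rw [← Measure.volume_eq_prod] at this
    rw [this, integral_sub_left_eq_self (fun x => ‖K1sq x‖)]
    simp only [Real.norm_of_nonneg (K1sq_nonneg _)]
  show Integrable (fun p : R3 × R3 => ∫ q : R3 × R3, ‖h p * (K1sq (p.1 - q.1) * W q.2)‖) _
  rw [this]
  exact hh.norm.mul_const _

/-- Pointwise control of elements of `F_M`. -/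
lemma pointwise_control {Φ Φ' : ℝ → ℝ} {k k' : ℝ} (hΦ : IsPhi Φ Φ' k k') :
    ∃ W : R3 → ℝ, Integrable W ∧ (∀ v, 0 ≤ W v) ∧ ∀ M f, MemFM Φ M f →
      ∃ h : R3 × R3 → ℝ, Integrable h ∧ (∀ p, 0 ≤ h p) ∧ ∀ p, f p ^ 4 ≤ h p ^ 3 * W p.2 := by
  obtain ⟨C, hC, F, hF, hg⟩ := hΦ.growth_large
  have hk := hΦ.k_pos
  have hk2 := hΦ.k_lt
  set α : ℝ := k / 3 with hα
  have hα0 : 0 < α := by positivity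
  have hα1 : α < 1 / 2 := by rw [hα]; linarith
  refine ⟨fun v => (1 + ‖v‖) ^ (-(6 * (1 - α))), ?_, fun v => by positivity, ?_⟩
  · refine integrable_one_add_norm ?_
    simp only [finrank_euclideanSpace, Fintype.card_fin]
    push_cast
    linarith
  intro M f hf
  refine ⟨fun p => F ^ (1 / k) * f p + C⁻¹ * Φ (f p) + 2 * f p + 2 * (‖p.2‖ ^ 2 * f p), ?_, ?_, ?_⟩
  · exact (((hf.integrable.const_mul _).add (hf.cas_int.const_mul _)).add
      (hf.integrable.const_mul _)).add (hf.kin_int.const_mul _)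
  · intro p
    have h1 := hf.nonneg p
    have h2 := hΦ.nonneg _ h1
    positivity
  · intro p
    have h1 := hf.nonneg p
    have h2 := hΦ.nonneg _ h1
    set s := f p
    set r := ‖p.2‖ with hr
    have hr0 : 0 ≤ r := norm_nonneg _
    have hsp : s ^ (1 + 1 / k) ≤ F ^ (1 / k) * s + C⁻¹ * Φ s := by
      rcases le_total F s with hs | hs
      · have := hg s hs
        have h3 : s ^ (1 + 1 / k) ≤ C⁻¹ * Φ s := by
          rw [inv_mul_eq_div, le_div_iff₀ hC]; linarith
        have : 0 ≤ F ^ (1 / k) * s := by positivity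
        linarith
      · have h3 : s ^ (1 + 1 / k) = s ^ (1 / k) * s := by
          rw [add_comm, Real.rpow_add_of_nonneg h1 (by positivity) (by norm_num), Real.rpow_one]
        have h4 : s ^ (1 / k) ≤ F ^ (1 / k) := Real.rpow_le_rpow h1 hs (by positivity)
        have : 0 ≤ C⁻¹ * Φ s := by positivity
        rw [h3]
        nlinarith
    have hge := Real.geom_mean_le_arith_mean2_weighted (w₁ := α) (w₂ := 1 - α)
      (p₁ := s ^ (1 + 1 / k)) (p₂ := s * (1 + r) ^ (2:ℝ)) hα0.le (by linarith) (by positivity)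
      (by positivity) (by ring)
    have hle : α * s ^ (1 + 1 / k) + (1 - α) * (s * (1 + r) ^ (2:ℝ)) ≤
        F ^ (1 / k) * s + C⁻¹ * Φ s + 2 * s + 2 * (r ^ 2 * s) := by
      have ha : 0 ≤ s ^ (1 + 1 / k) := by positivity
      have hb : s * (1 + r) ^ (2:ℝ) ≤ 2 * s + 2 * (r ^ 2 * s) := by
        rw [Real.rpow_two]; nlinarith [mul_nonneg h1 (sq_nonneg (r - 1))]
      have hb0 : 0 ≤ s * (1 + r) ^ (2:ℝ) := by positivity
      nlinarith
    set H := F ^ (1 / k) * s + C⁻¹ * Φ s + 2 * s + 2 * (r ^ 2 * s) with hH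
    have key : (s ^ (1 + 1 / k)) ^ α * (s * (1 + r) ^ (2:ℝ)) ^ (1 - α) =
        s ^ (4 / 3 : ℝ) * (1 + r) ^ (2 * (1 - α)) := by
      rw [Real.mul_rpow h1 (by positivity), ← Real.rpow_mul h1, ← Real.rpow_mul (by positivity),
        ← mul_assoc, ← Real.rpow_add_of_nonneg h1 (by positivity) (by linarith)]
      congr 2
      rw [hα]; field_simp; ring
    rw [key] at hge
    have hge2 := hge.trans hle
    have hpow := pow_le_pow_left₀ (by positivity) hge2 3
    have e1 : (s ^ (4 / 3 : ℝ) * (1 + r) ^ (2 * (1 - α))) ^ 3 =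
        s ^ 4 * (1 + r) ^ (6 * (1 - α)) := by
      rw [mul_pow, ← Real.rpow_natCast (s ^ (4 / 3 : ℝ)) 3, ← Real.rpow_mul h1,
        ← Real.rpow_natCast ((1 + r) ^ (2 * (1 - α))) 3, ← Real.rpow_mul (by positivity),
        ← Real.rpow_natCast s 4]
      congr 2
      · norm_num
      · push_cast; ring
    rw [e1] at hpow
    show s ^ 4 ≤ H ^ 3 * (1 + r) ^ (-(6 * (1 - α)))
    rw [Real.rpow_neg (by positivity), ← div_eq_mul_inv, le_div_iff₀ (by positivity)]
    exact hpow

lemma energy_integrable {Φ Φ' : ℝ → ℝ} {k k' : ℝ} (hΦ : IsPhi Φ Φ' k k') {M N : ℝ}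
    {f g : R3 × R3 → ℝ} (hf : MemFM Φ M f) (hg : MemFM Φ N g) :
    Integrable (fun z : (R3 × R3) × (R3 × R3) => f z.1 * g z.2 / ‖z.1.1 - z.2.1‖) := by
  obtain ⟨W, hW, hW0, hctl⟩ := pointwise_control hΦ
  obtain ⟨a, ha, ha0, hfa⟩ := hctl M f hf
  obtain ⟨b, hb, hb0, hgb⟩ := hctl N g hg
  have i1 : Integrable (fun z : (R3 × R3) × (R3 × R3) => f z.1 * g z.2) :=
    hf.integrable.mul_prod hg.integrable
  have i2 : Integrable (fun z : (R3 × R3) × (R3 × R3) => a z.1 * b z.2) := ha.mul_prod hb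
  have i3 := cross_integrable a ha W hW
  have i4 := (cross_integrable b hb W hW).swap
  refine (((i1.add i2).add i3).add i4).mono' ?_ (Eventually.of_forall fun z => ?_)
  · refine i1.aestronglyMeasurable.div₀ ?_
    exact Measurable.aestronglyMeasurable (by fun_prop)
  · obtain ⟨p, q⟩ := z
    have hfp := hf.nonneg p
    have hgq := hg.nonneg q
    have hsym : K1sq (q.1 - p.1) = K1sq (p.1 - q.1) := by
      unfold K1sq; rw [norm_sub_rev]
    simp only [Pi.add_apply, Function.comp_apply, Prod.swap, hsym]
    rw [Real.norm_of_nonneg (by positivity)]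
    have hA := ha0 p
    have hB := hb0 q
    have hK := K1sq_nonneg (p.1 - q.1)
    have hWp := hW0 p.2
    have hWq := hW0 q.2
    rcases lt_or_ge ‖p.1 - q.1‖ 1 with hlt | hge
    · have hKe : K1sq (p.1 - q.1) = (‖p.1 - q.1‖⁻¹) ^ 2 := by
        unfold K1sq; rw [if_pos hlt, inv_pow]
      set κ := ‖p.1 - q.1‖⁻¹ with hκ
      have hκ0 : 0 ≤ κ := by positivity
      rw [div_eq_mul_inv, ← hκ, hKe]
      have hu : 0 ≤ a p * (κ ^ 2 * W q.2) := by positivity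
      have hv : 0 ≤ b q * (κ ^ 2 * W p.2) := by positivity
      have hab : 0 ≤ a p * b q := by positivity
      have h4 : (f p * g q * κ) ^ 4 ≤
          (a p * b q + a p * (κ ^ 2 * W q.2) + b q * (κ ^ 2 * W p.2)) ^ 4 := by
        calc (f p * g q * κ) ^ 4 = f p ^ 4 * g q ^ 4 * κ ^ 4 := by ring
          _ ≤ (a p ^ 3 * W p.2) * (b q ^ 3 * W q.2) * κ ^ 4 := by
              gcongr
              · exact hfa p
              · exact hgb q
          _ = (a p * b q) ^ 2 * (a p * (κ ^ 2 * W q.2)) * (b q * (κ ^ 2 * W p.2)) := by ring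
          _ ≤ (a p * b q + a p * (κ ^ 2 * W q.2) + b q * (κ ^ 2 * W p.2)) ^ 2 *
                (a p * b q + a p * (κ ^ 2 * W q.2) + b q * (κ ^ 2 * W p.2)) *
                (a p * b q + a p * (κ ^ 2 * W q.2) + b q * (κ ^ 2 * W p.2)) := by
              gcongr <;> linarith
          _ = _ := by ring
      have := (pow_le_pow_iff_left₀ (by positivity) (by positivity) (by norm_num)).1 h4
      have : 0 ≤ f p * g q := by positivity
      linarith
    · have : f p * g q / ‖p.1 - q.1‖ ≤ f p * g q := div_le_self (by positivity) hge
      have h2 : 0 ≤ a p * b q := by positivity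
      have h3 : 0 ≤ a p * (K1sq (p.1 - q.1) * W q.2) := by positivity
      have h4 : 0 ≤ b q * (K1sq (p.1 - q.1) * W p.2) := by positivity
      linarith

/-- The interaction energy as a double phase-space integral. -/
def BB (f g : R3 × R3 → ℝ) : ℝ :=
  ∫ z : (R3 × R3) × (R3 × R3), f z.1 * g z.2 / ‖z.1.1 - z.2.1‖

lemma BB_symm (f g : R3 × R3 → ℝ) : BB f g = BB g f := by
  unfold BB
  rw [Measure.volume_eq_prod (R3 × R3) (R3 × R3), ← integral_prod_swap]
  refine integral_congr_ae (Eventually.of_forall fun z => ?_)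
  simp only [Prod.fst_swap, Prod.snd_swap]
  rw [norm_sub_rev, mul_comm]

lemma potential_pointwise {Φ Φ' : ℝ → ℝ} {k k' : ℝ} (hΦ : IsPhi Φ Φ' k k') {M N : ℝ}
    {f g : R3 × R3 → ℝ} (hf : MemFM Φ M f) (hg : MemFM Φ N g) :
    (fun p => ∫ q, f p * g q / ‖p.1 - q.1‖) =ᵐ[volume]
      fun p => f p * -U0rho (spatialDensity g) p.1 := by
  have h := (energy_integrable hΦ hf hg).prod_right_ae
  filter_upwards [h] with p hp
  by_cases h0 : f p = 0
  · simp [h0]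
  · have hp' : Integrable (fun q : R3 × R3 => g q / ‖p.1 - q.1‖) := by
      refine (hp.const_mul (f p)⁻¹).congr (Eventually.of_forall fun q => ?_)
      simp only
      field_simp
    simp only [mul_div_assoc]
    rw [integral_const_mul]
    congr 1
    rw [Measure.volume_eq_prod] at hp' ⊢
    rw [integral_prod _ hp']
    simp only [U0rho, spatialDensity, neg_neg, integral_div]

lemma potential_integrable {Φ Φ' : ℝ → ℝ} {k k' : ℝ} (hΦ : IsPhi Φ Φ' k k') {M N : ℝ}
    {f g : R3 × R3 → ℝ} (hf : MemFM Φ M f) (hg : MemFM Φ N g) :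
    Integrable (fun p => f p * -U0rho (spatialDensity g) p.1) :=
  (energy_integrable hΦ hf hg).integral_prod_left.congr (potential_pointwise hΦ hf hg)

lemma potential_integral {Φ Φ' : ℝ → ℝ} {k k' : ℝ} (hΦ : IsPhi Φ Φ' k k') {M N : ℝ}
    {f g : R3 × R3 → ℝ} (hf : MemFM Φ M f) (hg : MemFM Φ N g) :
    ∫ p, f p * -U0rho (spatialDensity g) p.1 = BB f g := by
  rw [← integral_congr_ae (potential_pointwise hΦ hf hg)]
  unfold BB
  rw [Measure.volume_eq_prod (R3 × R3) (R3 × R3), integral_prod]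
  exact energy_integrable hΦ hf hg

lemma Dpair_eq {Φ Φ' : ℝ → ℝ} {k k' : ℝ} (hΦ : IsPhi Φ Φ' k k') {N : ℝ}
    {g : R3 × R3 → ℝ} (hg : MemFM Φ N g) : Dpair (spatialDensity g) = BB g g := by
  rw [← potential_integral hΦ hg hg]
  have hi := potential_integrable hΦ hg hg
  rw [Measure.volume_eq_prod] at hi ⊢
  rw [integral_prod _ hi]
  unfold Dpair
  refine integral_congr_ae (Eventually.of_forall fun x => ?_)
  simp only
  rw [integral_mul_const]
  simp only [mul_div_assoc]
  rw [integral_const_mul]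
  simp only [U0rho, neg_neg]
  rfl

/-! ### Part B: the minimizer also minimizes the linearized functional -/

lemma phi_cont {Φ Φ' : ℝ → ℝ} {k k' : ℝ} (hΦ : IsPhi Φ Φ' k k') :
    Continuous (fun s => Φ (max s 0)) := by
  have h : ContinuousOn Φ (Ici 0) := fun s hs => (hΦ.hasDeriv s hs).continuousAt.continuousWithinAt
  exact h.comp_continuous (by fun_prop) (fun s => mem_Ici.2 (le_max_right s 0))

lemma phi'_cont {Φ Φ' : ℝ → ℝ} {k k' : ℝ} (hΦ : IsPhi Φ Φ' k k') :
    Continuous (fun s => Φ' (max s 0)) :=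
  hΦ.derivCont.comp_continuous (by fun_prop) (fun s => mem_Ici.2 (le_max_right s 0))

lemma phi_comp_meas {Φ Φ' : ℝ → ℝ} {k k' : ℝ} (hΦ : IsPhi Φ Φ' k k') {g : R3 × R3 → ℝ}
    (hg : AEStronglyMeasurable g) (hg0 : ∀ p, 0 ≤ g p) :
    AEStronglyMeasurable (fun p => Φ (g p)) := by
  have := (phi_cont hΦ).comp_aestronglyMeasurable hg
  refine this.congr (Eventually.of_forall fun p => ?_)
  simp [max_eq_left (hg0 p)]

lemma mix_pointwise {Φ Φ' : ℝ → ℝ} {k k' : ℝ} (hΦ : IsPhi Φ Φ' k k') {a b τ : ℝ}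
    (ha : 0 ≤ a) (hb : 0 ≤ b) (h0 : 0 ≤ τ) (h1 : τ ≤ 1) :
    Φ ((1 - τ) * a + τ * b) ≤ (1 - τ) * Φ a + τ * Φ b := by
  have := hΦ.sconvex.convexOn.2 (mem_Ici.2 ha) (mem_Ici.2 hb) (sub_nonneg.2 h1) h0 (by ring)
  simpa using this

lemma mix_mem {Φ Φ' : ℝ → ℝ} {k k' : ℝ} (hΦ : IsPhi Φ Φ' k k') {M : ℝ}
    {f g : R3 × R3 → ℝ} (hf : MemFM Φ M f) (hg : MemFM Φ M g) {τ : ℝ} (h0 : 0 ≤ τ) (h1 : τ ≤ 1) :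
    MemFM Φ M (fun p => (1 - τ) * f p + τ * g p) := by
  have h1' : 0 ≤ 1 - τ := by linarith
  have hnn : ∀ p, 0 ≤ (1 - τ) * f p + τ * g p := fun p => by
    have := hf.nonneg p
    have := hg.nonneg p
    positivity
  have hint : Integrable (fun p => (1 - τ) * f p + τ * g p) :=
    (hf.integrable.const_mul _).add (hg.integrable.const_mul _)
  refine ⟨hnn, hint, ?_, ?_, ?_⟩
  · rw [integral_add (hf.integrable.const_mul _) (hg.integrable.const_mul _), integral_const_mul,
      integral_const_mul, hf.mass, hg.mass]
    ring
  · refine ((hf.kin_int.const_mul (1 - τ)).add (hg.kin_int.const_mul τ)).congr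
      (Eventually.of_forall fun p => ?_)
    simp only [Pi.add_apply]
    ring
  · refine ((hf.cas_int.const_mul (1 - τ)).add (hg.cas_int.const_mul τ)).mono'
      (phi_comp_meas hΦ hint.aestronglyMeasurable hnn) (Eventually.of_forall fun p => ?_)
    rw [Real.norm_of_nonneg (hΦ.nonneg _ (hnn p))]
    exact mix_pointwise hΦ (hf.nonneg p) (hg.nonneg p) h0 h1

lemma BB_mix {Φ Φ' : ℝ → ℝ} {k k' : ℝ} (hΦ : IsPhi Φ Φ' k k') {M : ℝ}
    {f g : R3 × R3 → ℝ} (hf : MemFM Φ M f) (hg : MemFM Φ M g) (τ : ℝ) :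
    BB (fun p => (1 - τ) * f p + τ * g p) (fun p => (1 - τ) * f p + τ * g p) =
      (1 - τ) ^ 2 * BB f f + 2 * τ * (1 - τ) * BB g f + τ ^ 2 * BB g g := by
  have i1 := (energy_integrable hΦ hf hf).const_mul ((1 - τ) ^ 2)
  have i2 := (energy_integrable hΦ hf hg).const_mul (τ * (1 - τ))
  have i3 := (energy_integrable hΦ hg hf).const_mul (τ * (1 - τ))
  have i4 := (energy_integrable hΦ hg hg).const_mul (τ ^ 2)
  have hs : BB f g = BB g f := BB_symm f g
  have : BB (fun p => (1 - τ) * f p + τ * g p) (fun p => (1 - τ) * f p + τ * g p) =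
      (1 - τ) ^ 2 * BB f f + τ * (1 - τ) * BB f g + τ * (1 - τ) * BB g f + τ ^ 2 * BB g g := by
    unfold BB
    simp only [← integral_const_mul]
    rw [← integral_add' i1 i2, ← integral_add' (i1.add i2) i3, ← integral_add' ((i1.add i2).add i3) i4]
    refine integral_congr_ae (Eventually.of_forall fun z => ?_)
    simp only [Pi.add_apply]
    ring
  rw [this, hs]
  ring

lemma int_six {α : Type*} [MeasurableSpace α] {μ : Measure α} {a b c d e f : α → ℝ}
    (ha : Integrable a μ) (hb : Integrable b μ) (hc : Integrable c μ) (hd : Integrable d μ)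
    (he : Integrable e μ) (hf : Integrable f μ) :
    ∫ p, (a p - b p + c p - d p - e p + f p) ∂μ =
      (∫ p, a p ∂μ) - (∫ p, b p ∂μ) + (∫ p, c p ∂μ) - (∫ p, d p ∂μ) - (∫ p, e p ∂μ)
        + ∫ p, f p ∂μ := by
  have j1 : Integrable (fun p => a p - b p) μ := ha.sub hb
  have j2 : Integrable (fun p => a p - b p + c p) μ := j1.add hc
  have j3 : Integrable (fun p => a p - b p + c p - d p) μ := j2.sub hd
  have j4 : Integrable (fun p => a p - b p + c p - d p - e p) μ := j3.sub he
  rw [integral_add j4 hf, integral_sub j3 he, integral_sub j2 hd, integral_add j1 hc,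
    integral_sub ha hb]

lemma dVP_integrable {Φ Φ' : ℝ → ℝ} {k k' : ℝ} (hΦ : IsPhi Φ Φ' k k') {M : ℝ}
    {f g : R3 × R3 → ℝ} (hf : MemFM Φ M f) (hg : MemFM Φ M g) :
    Integrable (fun p => Φ (g p) - Φ (f p) + Epart f p * (g p - f p)) ∧
    dVP Φ f g = Casimir Φ g - Casimir Φ f + Ekin g - Ekin f - BB g f + BB f f := by
  have i1 := hg.cas_int
  have i2 := hf.cas_int
  have i3 := hg.kin_int.const_mul (1 / 2)
  have i4 := hf.kin_int.const_mul (1 / 2)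
  have i5 := potential_integrable hΦ hg hf
  have i6 := potential_integrable hΦ hf hf
  have e : (fun p => Φ (g p) - Φ (f p) + Epart f p * (g p - f p)) =
      fun p => Φ (g p) - Φ (f p) + (1 / 2) * (‖p.2‖ ^ 2 * g p) - (1 / 2) * (‖p.2‖ ^ 2 * f p)
        - (g p * -U0rho (spatialDensity f) p.1) + f p * -U0rho (spatialDensity f) p.1 := by
    funext p
    unfold Epart
    ring
  refine ⟨?_, ?_⟩
  · rw [e]
    exact ((((i1.sub i2).add i3).sub i4).sub i5).add i6
  · unfold dVP
    rw [e, int_six i1 i2 i3 i4 i5 i6, potential_integral hΦ hg hf,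
      potential_integral hΦ hf hf, integral_const_mul, integral_const_mul]
    rfl

lemma dVP_nonneg {Φ Φ' : ℝ → ℝ} {k k' : ℝ} (hΦ : IsPhi Φ Φ' k k') {M : ℝ}
    {f g : R3 × R3 → ℝ} (hf : MemFM Φ M f) (hmin : ∀ g, MemFM Φ M g → HC Φ f ≤ HC Φ g)
    (hg : MemFM Φ M g) : 0 ≤ dVP Φ f g := by
  rw [(dVP_integrable hΦ hf hg).2]
  set X := Casimir Φ g - Casimir Φ f + Ekin g - Ekin f - BB g f + BB f f with hX
  set Y := -(1 / 2) * (BB f f - 2 * BB g f + BB g g) with hY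
  have key : ∀ τ : ℝ, 0 < τ → τ ≤ 1 → 0 ≤ X + τ * Y := by
    intro τ h0 h1
    have hm := mix_mem hΦ hf hg h0.le h1
    have h := hmin _ hm
    have hk : Ekin (fun p => (1 - τ) * f p + τ * g p) = (1 - τ) * Ekin f + τ * Ekin g := by
      unfold Ekin
      have : (fun p : R3 × R3 => ‖p.2‖ ^ 2 * ((1 - τ) * f p + τ * g p)) =
          fun p => (1 - τ) * (‖p.2‖ ^ 2 * f p) + τ * (‖p.2‖ ^ 2 * g p) := by
        funext p; ring
      rw [this, integral_add (hf.kin_int.const_mul _) (hg.kin_int.const_mul _),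
        integral_const_mul, integral_const_mul]
      ring
    have hc : Casimir Φ (fun p => (1 - τ) * f p + τ * g p) ≤
        (1 - τ) * Casimir Φ f + τ * Casimir Φ g := by
      unfold Casimir
      rw [← integral_const_mul, ← integral_const_mul,
        ← integral_add (hf.cas_int.const_mul _) (hg.cas_int.const_mul _)]
      refine integral_mono hm.cas_int ((hf.cas_int.const_mul _).add (hg.cas_int.const_mul _)) ?_
      intro p
      exact mix_pointwise hΦ (hf.nonneg p) (hg.nonneg p) h0.le h1
    unfold HC Epot at h
    rw [Dpair_eq hΦ hf, Dpair_eq hΦ hm, BB_mix hΦ hf hg, hk] at h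
    have h2 : 0 ≤ τ * (X + τ * Y) := by
      rw [hX, hY]
      nlinarith
    exact nonneg_of_mul_nonneg_right h2 h0
  by_contra hneg
  push Not at hneg
  have hY1 : 0 < |Y| + 1 := by positivity
  have hτ : 0 < min 1 (-X / (2 * (|Y| + 1))) := by
    refine lt_min one_pos ?_
    have : 0 < -X := by linarith
    positivity
  set τ := min 1 (-X / (2 * (|Y| + 1))) with hτd
  have h := key τ hτ (min_le_left _ _)
  have h2 : τ ≤ -X / (2 * (|Y| + 1)) := min_le_right _ _
  rw [le_div_iff₀ (by positivity)] at h2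
  have h3 : τ * Y ≤ τ * |Y| := by gcongr; exact le_abs_self Y
  nlinarith

/-! ### Part C: mass-exchange variations -/

lemma phi'_strictMono {Φ Φ' : ℝ → ℝ} {k k' : ℝ} (hΦ : IsPhi Φ Φ' k k') :
    StrictMonoOn Φ' (Ici 0) := by
  have h := hΦ.sconvex.strictMonoOn_deriv (fun x hx => (hΦ.hasDeriv x hx).differentiableAt)
  intro x hx y hy hxy
  have := h hx hy hxy
  rwa [(hΦ.hasDeriv x hx).deriv, (hΦ.hasDeriv y hy).deriv] at this

lemma phi_tangent {Φ Φ' : ℝ → ℝ} {k k' : ℝ} (hΦ : IsPhi Φ Φ' k k') {x y : ℝ} (hx : 0 ≤ x)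
    (hxy : x ≤ y) : (y - x) * Φ' x ≤ Φ y - Φ x ∧ Φ y - Φ x ≤ (y - x) * Φ' y := by
  rcases hxy.eq_or_lt with rfl | hlt
  · simp
  have hx' : x ∈ Ici (0:ℝ) := hx
  have hy' : y ∈ Ici (0:ℝ) := hx.trans hxy
  have h1 := hΦ.sconvex.convexOn.le_slope_of_hasDerivAt hx' hy' hlt (hΦ.hasDeriv x hx')
  have h2 := hΦ.sconvex.convexOn.slope_le_of_hasDerivAt hx' hy' hlt (hΦ.hasDeriv y hy')
  have hpos : 0 < y - x := by linarith
  rw [slope_def_field, le_div_iff₀ hpos] at h1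
  rw [slope_def_field, div_le_iff₀ hpos] at h2
  constructor <;> linarith

lemma phi'_nonneg {Φ Φ' : ℝ → ℝ} {k k' : ℝ} (hΦ : IsPhi Φ Φ' k k') {x : ℝ} (hx : 0 ≤ x) :
    0 ≤ Φ' x := by
  have := (phi'_strictMono hΦ).monotoneOn (mem_Ici.2 le_rfl) (mem_Ici.2 hx) hx
  rwa [hΦ.deriv_zero] at this

lemma phi_mono {Φ Φ' : ℝ → ℝ} {k k' : ℝ} (hΦ : IsPhi Φ Φ' k k') {x y : ℝ} (hx : 0 ≤ x)
    (hxy : x ≤ y) : Φ x ≤ Φ y := by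
  have h1 := (phi_tangent hΦ hx hxy).1
  have h2 := phi'_nonneg hΦ hx
  nlinarith [mul_nonneg (sub_nonneg.2 hxy) h2]

lemma ind_integrable {A : Set (R3 × R3)} (hA : MeasurableSet A) (hfin : volume A ≠ ⊤) (s : ℝ) :
    Integrable (A.indicator (fun _ => s)) :=
  (integrable_indicator_iff hA).2 (integrableOn_const hfin)

lemma kin_ind_integrable {A : Set (R3 × R3)} (hA : MeasurableSet A) (hfin : volume A ≠ ⊤) (s R : ℝ)
    (hR : ∀ p ∈ A, ‖p.2‖ ≤ R) :
    Integrable (fun p : R3 × R3 => ‖p.2‖ ^ 2 * A.indicator (fun _ => s) p) := by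
  refine (ind_integrable hA hfin (R ^ 2 * |s|)).mono' ?_ (Eventually.of_forall fun p => ?_)
  · exact AEStronglyMeasurable.mul (by fun_prop) (ind_integrable hA hfin s).aestronglyMeasurable
  · by_cases hp : p ∈ A
    · simp only [indicator_of_mem hp, norm_mul, norm_pow, Real.norm_eq_abs, abs_norm]
      have := hR p hp
      gcongr
    · simp [indicator_of_notMem hp]

lemma exchange {Φ Φ' : ℝ → ℝ} {k k' : ℝ} (hΦ : IsPhi Φ Φ' k k') {M : ℝ}
    {f : R3 × R3 → ℝ} (hf : MemFM Φ M f) (hmin : ∀ g, MemFM Φ M g → HC Φ f ≤ HC Φ g)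
    {a b δ R : ℝ} (hab : a < b) (hδ : 0 < δ) {A B : Set (R3 × R3)}
    (mA : MeasurableSet A) (mB : MeasurableSet B)
    (fA : volume A ≠ ⊤) (fB : volume B ≠ ⊤) (pA : volume A ≠ 0) (pB : volume B ≠ 0)
    (hA : ∀ p ∈ A, δ ≤ f p ∧ ‖p.2‖ ≤ R ∧ b ≤ Φ' (f p - δ) + Epart f p)
    (hB : ∀ p ∈ B, f p ≤ R ∧ ‖p.2‖ ≤ R ∧ Φ' (f p + δ) + Epart f p ≤ a) : False := by
  have hmono := (phi'_strictMono hΦ).monotoneOn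
  have hdisj : ∀ p ∈ A, p ∉ B := by
    intro p hpA hpB
    obtain ⟨h1, -, h2⟩ := hA p hpA
    obtain ⟨-, -, h3⟩ := hB p hpB
    have := hmono (mem_Ici.2 (by linarith : 0 ≤ f p - δ)) (mem_Ici.2 (by linarith : 0 ≤ f p + δ))
      (by linarith)
    linarith
  set α := volume.real A with hα
  set β := volume.real B with hβ
  have hα0 : 0 < α := ENNReal.toReal_pos pA fA
  have hβ0 : 0 < β := ENNReal.toReal_pos pB fB
  set c := δ / (α + β) with hc
  have hc0 : 0 < c := by positivity
  have hcs : c * (α + β) = δ := by rw [hc]; field_simp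
  set t := c * α with ht
  set s := c * β with hs
  have ht0 : 0 < t := by positivity
  have hs0 : 0 < s := by positivity
  have htδ : t ≤ δ := by nlinarith
  have hsδ : s ≤ δ := by nlinarith
  set g : R3 × R3 → ℝ := fun p => f p - A.indicator (fun _ => s) p + B.indicator (fun _ => t) p
    with hg
  have gA : ∀ p ∈ A, g p = f p - s := by
    intro p hp; simp [hg, indicator_of_mem hp, indicator_of_notMem (hdisj p hp)]
  have gB : ∀ p ∈ B, g p = f p + t := by
    intro p hp
    have : p ∉ A := fun h => hdisj p h hp
    simp [hg, indicator_of_mem hp, indicator_of_notMem this]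
  have gO : ∀ p, p ∉ A → p ∉ B → g p = f p := by
    intro p h1 h2; simp [hg, indicator_of_notMem h1, indicator_of_notMem h2]
  have iA := ind_integrable mA fA s
  have iB := ind_integrable mB fB t
  have gnn : ∀ p, 0 ≤ g p := by
    intro p
    have := hf.nonneg p
    by_cases h1 : p ∈ A
    · rw [gA p h1]; linarith [(hA p h1).1]
    · by_cases h2 : p ∈ B
      · rw [gB p h2]; linarith
      · rw [gO p h1 h2]; exact this
  have gint : Integrable g := (hf.integrable.sub iA).add iB
  have gmem : MemFM Φ M g := by
    refine ⟨gnn, gint, ?_, ?_, ?_⟩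
    · have j : Integrable (fun p => f p - A.indicator (fun _ => s) p) := hf.integrable.sub iA
      rw [hg, integral_add j iB, integral_sub hf.integrable iA, integral_indicator_const _ mA,
        integral_indicator_const _ mB, hf.mass, smul_eq_mul, smul_eq_mul, ← hα, ← hβ, ht, hs]
      ring
    · refine ((hf.kin_int.sub (kin_ind_integrable mA fA s R fun p hp => (hA p hp).2.1)).add
        (kin_ind_integrable mB fB t R fun p hp => (hB p hp).2.1)).congr
        (Eventually.of_forall fun p => ?_)
      simp only [hg, Pi.add_apply, Pi.sub_apply]
      ring
    · refine (hf.cas_int.add (ind_integrable mB fB (Φ (R + δ)))).mono'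
        (phi_comp_meas hΦ gint.aestronglyMeasurable gnn) (Eventually.of_forall fun p => ?_)
      rw [Real.norm_of_nonneg (hΦ.nonneg _ (gnn p))]
      simp only [Pi.add_apply]
      have hfp := hf.nonneg p
      have hΦp := hΦ.nonneg _ hfp
      by_cases h1 : p ∈ A
      · rw [indicator_of_notMem (hdisj p h1), add_zero]
        refine phi_mono hΦ (gnn p) ?_
        rw [gA p h1]; linarith
      · by_cases h2 : p ∈ B
        · rw [indicator_of_mem h2]
          have : Φ (g p) ≤ Φ (R + δ) := by
            refine phi_mono hΦ (gnn p) ?_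
            rw [gB p h2]; linarith [(hB p h2).1]
          linarith
        · rw [gO p h1 h2, indicator_of_notMem h2, add_zero]
  have hnn := dVP_nonneg hΦ hf hmin gmem
  have hi := (dVP_integrable hΦ hf gmem).1
  have jA := ind_integrable mA fA (-(s * b))
  have jB := ind_integrable mB fB (t * a)
  have hle : dVP Φ f g ≤ ∫ p, (A.indicator (fun _ => -(s * b)) p + B.indicator (fun _ => t * a) p) := by
    unfold dVP
    refine integral_mono hi (jA.add jB) fun p => ?_
    have hfp := hf.nonneg p
    simp only
    by_cases h1 : p ∈ A
    · rw [indicator_of_mem h1, indicator_of_notMem (hdisj p h1), gA p h1, add_zero]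
      obtain ⟨k1, -, k2⟩ := hA p h1
      have h3 := (phi_tangent hΦ (x := f p - s) (y := f p) (by linarith) (by linarith)).1
      have h4 := hmono (mem_Ici.2 (by linarith : 0 ≤ f p - δ)) (mem_Ici.2 (by linarith : 0 ≤ f p - s))
        (by linarith)
      have h5 : s * b ≤ s * (Φ' (f p - s) + Epart f p) :=
        mul_le_mul_of_nonneg_left (by linarith) hs0.le
      nlinarith
    · by_cases h2 : p ∈ B
      · rw [indicator_of_mem h2, indicator_of_notMem h1, gB p h2, zero_add]
        obtain ⟨-, -, k2⟩ := hB p h2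
        have h3 := (phi_tangent hΦ (x := f p) (y := f p + t) hfp (by linarith)).2
        have h4 := hmono (mem_Ici.2 (by linarith : 0 ≤ f p + t))
          (mem_Ici.2 (by linarith : 0 ≤ f p + δ)) (by linarith)
        have h5 : t * (Φ' (f p + t) + Epart f p) ≤ t * a :=
          mul_le_mul_of_nonneg_left (by linarith) ht0.le
        nlinarith
      · rw [indicator_of_notMem h2, indicator_of_notMem h1, gO p h1 h2]
        simp
  rw [integral_add jA jB, integral_indicator_const _ mA, integral_indicator_const _ mB,
    smul_eq_mul, smul_eq_mul, ← hα, ← hβ, ht, hs] at hle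
  have : 0 < c * α * β * (b - a) := by
    have : 0 < b - a := by linarith
    positivity
  nlinarith

lemma Epart_meas {f : R3 × R3 → ℝ} (hf : Integrable f) :
    AEMeasurable (Epart f) (volume : Measure (R3 × R3)) := by
  unfold Epart
  refine AEMeasurable.add (by fun_prop) ?_
  have h1 : AEStronglyMeasurable (spatialDensity f) :=
    hf.aestronglyMeasurable.integral_prod_right'
  have h2 : AEStronglyMeasurable (fun z : R3 × R3 => spatialDensity f z.2 / ‖z.1 - z.2‖) :=
    (h1.comp_snd (μ := (volume : Measure R3))).div₀
      (Measurable.aestronglyMeasurable (by fun_prop))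
  have h3 : AEStronglyMeasurable (U0rho (spatialDensity f)) := h2.integral_prod_right'.neg
  exact (h3.comp_fst (ν := (volume : Measure R3))).aemeasurable

lemma dichotomy {Φ Φ' : ℝ → ℝ} {k k' : ℝ} (hΦ : IsPhi Φ Φ' k k') {M : ℝ}
    {f : R3 × R3 → ℝ} (hf : MemFM Φ M f) (hmin : ∀ g, MemFM Φ M g → HC Φ f ≤ HC Φ g)
    {a b : ℝ} (hab : a < b) :
    volume {p | 0 < f p ∧ b < Φ' (f p) + Epart f p} = 0 ∨
      volume {p | Φ' (f p) + Epart f p < a} = 0 := by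
  by_contra hcon
  push Not at hcon
  obtain ⟨hA, hB⟩ := hcon
  have hmono := (phi'_strictMono hΦ).monotoneOn
  have hfm := hf.integrable.aestronglyMeasurable.aemeasurable
  have hEm := Epart_meas hf.integrable
  have hΦm := (phi'_cont hΦ).measurable
  let d : ℕ → ℝ := fun n => 1 / ((n : ℝ) + 1)
  have hd0 : ∀ n, 0 < d n := fun n => by positivity
  have hdlim : Tendsto d atTop (𝓝 0) := tendsto_one_div_add_atTop_nhds_zero_nat
  have hnorm : Measurable (fun p : R3 × R3 => ‖p‖) := measurable_norm
  let An : ℕ → Set (R3 × R3) := fun n =>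
    {p | d n ≤ f p} ∩ {p | ‖p‖ ≤ n} ∩ {p | b ≤ Φ' (max (f p - d n) 0) + Epart f p}
  let Bn : ℕ → Set (R3 × R3) := fun n =>
    {p | f p ≤ n} ∩ {p | ‖p‖ ≤ n} ∩ {p | Φ' (max (f p + d n) 0) + Epart f p ≤ a}
  have mA : ∀ n, NullMeasurableSet (An n) volume := fun n =>
    ((nullMeasurableSet_le aemeasurable_const hfm).inter
      (measurableSet_le hnorm measurable_const).nullMeasurableSet).inter
      (nullMeasurableSet_le aemeasurable_const
        ((hΦm.comp_aemeasurable (hfm.sub_const _)).add hEm))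
  have mB : ∀ n, NullMeasurableSet (Bn n) volume := fun n =>
    ((nullMeasurableSet_le hfm aemeasurable_const).inter
      (measurableSet_le hnorm measurable_const).nullMeasurableSet).inter
      (nullMeasurableSet_le ((hΦm.comp_aemeasurable (hfm.add_const _)).add hEm)
        aemeasurable_const)
  have cA : ∀ p, 0 < f p → b < Φ' (f p) + Epart f p → ∀ᶠ n in atTop, p ∈ An n := by
    intro p h1 h2
    have hlim : Tendsto (fun n => Φ' (max (f p - d n) 0) + Epart f p) atTop
        (𝓝 (Φ' (f p) + Epart f p)) := by
      have := ((phi'_cont hΦ).tendsto (f p - 0)).comp (tendsto_const_nhds.sub hdlim)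
      simp only [sub_zero, max_eq_left h1.le] at this
      exact this.add_const _
    filter_upwards [hlim.eventually_const_lt h2, hdlim.eventually_lt_const h1,
      eventually_ge_atTop ⌈‖p‖⌉₊] with n e1 e2 e3
    exact ⟨⟨e2.le, Nat.ceil_le.1 e3⟩, e1.le⟩
  have cB : ∀ p, Φ' (f p) + Epart f p < a → ∀ᶠ n in atTop, p ∈ Bn n := by
    intro p h2
    have hlim : Tendsto (fun n => Φ' (max (f p + d n) 0) + Epart f p) atTop
        (𝓝 (Φ' (f p) + Epart f p)) := by
      have := ((phi'_cont hΦ).tendsto (f p + 0)).comp (tendsto_const_nhds.add hdlim)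
      simp only [add_zero, max_eq_left (hf.nonneg p)] at this
      exact this.add_const _
    filter_upwards [hlim.eventually_lt_const h2, eventually_ge_atTop ⌈f p⌉₊,
      eventually_ge_atTop ⌈‖p‖⌉₊] with n e1 e2 e3
    exact ⟨⟨Nat.ceil_le.1 e2,
      Nat.ceil_le.1 e3⟩, e1.le⟩
  have posn : ∀ (S : Set (R3 × R3)) (T : ℕ → Set (R3 × R3)), volume S ≠ 0 →
      (∀ p ∈ S, ∀ᶠ n in atTop, p ∈ T n) → ∃ n, volume (T n) ≠ 0 := by
    intro S T hS hT
    by_contra hne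
    push Not at hne
    apply hS
    refine measure_mono_null (t := ⋃ n, T n) (fun p hp => ?_) (measure_iUnion_null hne)
    obtain ⟨n, hn⟩ := (hT p hp).exists
    exact mem_iUnion.2 ⟨n, hn⟩
  obtain ⟨n, hn⟩ := posn _ An hA fun p hp => cA p hp.1 hp.2
  obtain ⟨m, hm⟩ := posn _ Bn hB fun p hp => cB p hp
  obtain ⟨A, sA, mA', eA⟩ := (mA n).exists_measurable_subset_ae_eq
  obtain ⟨B, sB, mB', eB⟩ := (mB m).exists_measurable_subset_ae_eq
  have bdd : ∀ (j : ℕ) (S : Set (R3 × R3)), (∀ p ∈ S, ‖p‖ ≤ j) → volume S ≠ ⊤ := by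
    intro j S hS
    refine ne_top_of_le_ne_top (measure_closedBall_lt_top (x := (0 : R3 × R3)) (r := j)).ne
      (measure_mono fun p hp => ?_)
    simpa using hS p hp
  refine exchange hΦ hf hmin (δ := min (d n) (d m)) (R := max n m) hab
    (lt_min (hd0 n) (hd0 m)) mA' mB'
    (bdd n A fun p hp => (sA hp).1.2) (bdd m B fun p hp => (sB hp).1.2)
    (by rwa [measure_congr eA]) (by rwa [measure_congr eB]) ?_ ?_
  · intro p hp
    obtain ⟨⟨h1, h2⟩, h3⟩ := sA hp
    have h1 : d n ≤ f p := h1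
    have h2 : ‖p‖ ≤ n := h2
    have h3 : b ≤ Φ' (max (f p - d n) 0) + Epart f p := h3
    rw [max_eq_left (by linarith)] at h3
    have hmn := min_le_left (d n) (d m)
    refine ⟨hmn.trans h1, (norm_snd_le p).trans (h2.trans (le_max_left _ _)), ?_⟩
    have := hmono (mem_Ici.2 (by linarith : 0 ≤ f p - d n))
      (mem_Ici.2 (by linarith : 0 ≤ f p - min (d n) (d m))) (by linarith)
    linarith
  · intro p hp
    obtain ⟨⟨h1, h2⟩, h3⟩ := sB hp
    have h1 : f p ≤ m := h1
    have h2 : ‖p‖ ≤ m := h2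
    have h3 : Φ' (max (f p + d m) 0) + Epart f p ≤ a := h3
    have hfp := hf.nonneg p
    have hdm := hd0 m
    have hmin0 := lt_min (hd0 n) (hd0 m)
    rw [max_eq_left (by linarith)] at h3
    have hmn := min_le_right (d n) (d m)
    refine ⟨h1.trans (le_max_right _ _), (norm_snd_le p).trans (h2.trans (le_max_right _ _)), ?_⟩
    have := hmono (mem_Ici.2 (by linarith : 0 ≤ f p + min (d n) (d m)))
      (mem_Ici.2 (by linarith : 0 ≤ f p + d m)) (by linarith)
    linarith

/-- Euler-Lagrange identity for a minimizer of the energy-Casimir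
functional: `f₀ = (Φ')⁻¹(E₀ - E)` where `E < E₀` and `f₀ = 0` where `E ≥ E₀`. -/
theorem eulerLagrange_vlasov
    (Φ Φ' : ℝ → ℝ) (k k' : ℝ) (hΦ : IsPhi Φ Φ' k k') (M : ℝ) (hM : 0 < M)
    (f₀ : R3 × R3 → ℝ) (hf₀ : MemFM Φ M f₀)
    (hmin : ∀ g, MemFM Φ M g → HC Φ f₀ ≤ HC Φ g) :
    ∃ E₀ : ℝ, ∀ᵐ p ∂(volume : Measure (R3 × R3)),
      (Epart f₀ p < E₀ → 0 < f₀ p ∧ Φ' (f₀ p) = E₀ - Epart f₀ p) ∧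
      (E₀ ≤ Epart f₀ p → f₀ p = 0) := by
  set e : R3 × R3 → ℝ := fun p => Φ' (f₀ p) + Epart f₀ p with he
  have hdich : ∀ a b : ℝ, a < b → volume {p | 0 < f₀ p ∧ b < e p} = 0 ∨
      volume {p | e p < a} = 0 := fun a b hab => dichotomy hΦ hf₀ hmin hab
  have hpos : volume {p | 0 < f₀ p} ≠ 0 := by
    intro h0
    have : f₀ =ᵐ[volume] 0 := by
      have h1 : ∀ᵐ p ∂(volume : Measure (R3 × R3)), ¬ 0 < f₀ p := by
        rw [ae_iff]; simpa using h0
      filter_upwards [h1] with p hp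
      exact le_antisymm (not_lt.1 hp) (hf₀.nonneg p)
    have h2 := hf₀.mass
    rw [integral_congr_ae this] at h2
    simp at h2
    linarith
  set S : Set ℝ := {b | volume {p | 0 < f₀ p ∧ b < e p} = 0} with hS
  have hup : ∀ b ∈ S, ∀ c, b ≤ c → c ∈ S := by
    intro b hb c hbc
    have hsub : {p | 0 < f₀ p ∧ c < e p} ⊆ {p | 0 < f₀ p ∧ b < e p} :=
      fun p hp => ⟨hp.1, lt_of_le_of_lt hbc hp.2⟩
    exact measure_mono_null hsub hb
  have hne : S.Nonempty := by
    by_contra hemp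
    rw [not_nonempty_iff_eq_empty] at hemp
    have h1 : ∀ n : ℕ, volume {p | e p < n} = 0 := by
      intro n
      rcases hdich n (n + 1) (by linarith) with h | h
      · have : (n + 1 : ℝ) ∈ S := h
        rw [hemp] at this
        exact this.elim
      · exact h
    apply hpos
    refine measure_mono_null (t := ⋃ n : ℕ, {p | e p < n}) (fun p _ => ?_) (measure_iUnion_null h1)
    obtain ⟨n, hn⟩ := exists_nat_gt (e p)
    exact mem_iUnion.2 ⟨n, hn⟩
  have hbb : BddBelow S := by
    by_contra hnb
    rw [not_bddBelow_iff] at hnb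
    have h1 : ∀ n : ℕ, volume {p | 0 < f₀ p ∧ -(n : ℝ) < e p} = 0 := by
      intro n
      obtain ⟨b, hb, hlt⟩ := hnb (-(n : ℝ))
      exact hup b hb _ hlt.le
    apply hpos
    refine measure_mono_null (t := ⋃ n : ℕ, {p | 0 < f₀ p ∧ -(n : ℝ) < e p}) (fun p hp => ?_)
      (measure_iUnion_null h1)
    obtain ⟨n, hn⟩ := exists_nat_gt (-e p)
    exact mem_iUnion.2 ⟨n, hp, by linarith⟩
  refine ⟨sInf S, ?_⟩
  set E₀ := sInf S with hE₀
  have hupper : ∀ᵐ p ∂(volume : Measure (R3 × R3)), ¬ (0 < f₀ p ∧ E₀ < e p) := by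
    rw [ae_iff]
    simp only [not_not]
    refine measure_mono_null (t := ⋃ n : ℕ, {p | 0 < f₀ p ∧ E₀ + 1 / ((n : ℝ) + 1) < e p})
      (fun p hp => ?_) (measure_iUnion_null fun n => ?_)
    · obtain ⟨n, hn⟩ := exists_nat_one_div_lt (sub_pos.2 hp.2)
      exact mem_iUnion.2 ⟨n, hp.1, by linarith⟩
    · have hlt : sInf S < E₀ + 1 / ((n : ℝ) + 1) := by
        have : (0:ℝ) < 1 / ((n : ℝ) + 1) := by positivity
        linarith
      obtain ⟨b, hb, hb2⟩ := exists_lt_of_csInf_lt hne hlt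
      exact hup b hb _ hb2.le
  have hlower : ∀ᵐ p ∂(volume : Measure (R3 × R3)), ¬ (e p < E₀) := by
    rw [ae_iff]
    simp only [not_not]
    refine measure_mono_null (t := ⋃ n : ℕ, {p | e p < E₀ - 1 / ((n : ℝ) + 1)})
      (fun p hp => ?_) (measure_iUnion_null fun n => ?_)
    · obtain ⟨n, hn⟩ := exists_nat_one_div_lt (sub_pos.2 (show e p < E₀ from hp))
      exact mem_iUnion.2 ⟨n, by show e p < E₀ - 1 / ((n : ℝ) + 1); linarith⟩
    · have h0 : (0:ℝ) < 1 / ((n : ℝ) + 1) := by positivity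
      rcases hdich (E₀ - 1 / ((n : ℝ) + 1)) (E₀ - 1 / ((n : ℝ) + 1) / 2) (by linarith) with h | h
      · have : E₀ ≤ E₀ - 1 / ((n : ℝ) + 1) / 2 := csInf_le hbb h
        linarith
      · exact h
  filter_upwards [hupper, hlower] with p h1 h2
  have hfp := hf₀.nonneg p
  have heq : 0 < f₀ p → Φ' (f₀ p) + Epart f₀ p = E₀ := by
    intro hp
    refine le_antisymm ?_ (not_lt.1 h2)
    by_contra hcon
    exact h1 ⟨hp, not_le.1 hcon⟩
  constructor
  · intro hE
    have hp : 0 < f₀ p := by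
      rcases hfp.eq_or_lt with h | h
      · exfalso
        apply h2
        simp only [he]
        rw [← h, hΦ.deriv_zero]
        linarith
      · exact h
    exact ⟨hp, by linarith [heq hp]⟩
  · intro hE
    by_contra hne0
    have hp : 0 < f₀ p := lt_of_le_of_ne hfp (Ne.symm hne0)
    have h3 := heq hp
    have h4 := phi'_strictMono hΦ (mem_Ici.2 le_rfl) (mem_Ici.2 hfp) hp
    rw [hΦ.deriv_zero] at h4
    linarith
end
end

section
/- Let f₀ ∈ F_M be a minimizer of H_C satisfying the Euler-Lagrange identity with multiplier E₀ (f₀ = (Φ')⁻¹(E₀ - E) where E < E₀ and f₀ = 0 where E ≥ E₀, with E(x,v) = (1/2)|v|² + U₀(x)). Then for every f ∈ F_M the expansion H_C(f) - H_C(f₀) = d(f,f₀) - (1/2)D(ρ_f - ρ_{f₀}) holds, where d(f,f₀) := ∫∫ [Φ(f) - Φ(f₀) + E·(f - f₀)] dv dx satisfies d(f,f₀) ≥ ∫∫ [Φ'(f₀) + E - E₀](f - f₀) dv dx ≥ 0, and d(f,f₀) = 0 if and only if f = f₀ almost everywhere. -/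
open MeasureTheory Filter Topology Set ENNReal

noncomputable section

/-- Truncated kernel `|z|^{-2}` on the unit ball. -/
def K2 (z : R3) : ℝ := if ‖z‖ ≤ 1 then (‖z‖⁻¹) ^ 2 else 0

lemma K2_integrable : Integrable K2 := by
  have h := (integrable_fun_norm_addHaar (volume : Measure R3)
    (f := fun r : ℝ => if r ≤ 1 then (r⁻¹) ^ 2 else 0)).2 ?_
  · exact h
  · have h1 : IntegrableOn (fun _ : ℝ => (1:ℝ)) (Ioc 0 1) := by
      apply integrableOn_const <;> simp
    have h2 : IntegrableOn ((Iic (1:ℝ)).indicator (fun _ : ℝ => (1:ℝ))) (Ioi 0) := by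
      rw [← Ioi_inter_Iic] at h1
      rw [IntegrableOn, integrable_indicator_iff measurableSet_Iic, IntegrableOn,
        Measure.restrict_restrict measurableSet_Iic, inter_comm]
      exact h1
    refine h2.congr_fun ?_ measurableSet_Ioi
    intro y hy
    have hy' : (0:ℝ) < y := hy
    by_cases h : y ≤ 1
    · simp [h, hy'.ne']
    · simp [h]

lemma cube_root (a : ℝ) (ha : 0 ≤ a) : (a ^ (1/3:ℝ)) ^ 3 = a := by
  rw [← Real.rpow_natCast, ← Real.rpow_mul ha]; norm_num

lemma young_aux (A B r : ℝ) (hA : 0 ≤ A) (hB : 0 ≤ B) (hr : 0 ≤ r) :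
    A ^ 3 * B ^ 3 * r ≤ A ^ 4 * B ^ 4 + A ^ 4 * r ^ 2 + B ^ 4 * r ^ 2 := by
  have h1 : 0 ≤ (A*B)^2 * (A*B - r)^2 := by positivity
  have h2 : 0 ≤ r^2 * (A^2 - B^2)^2 := by positivity
  have h3 : 0 ≤ A^4 * B^4 := by positivity
  have h4 : 0 ≤ A^4 * r^2 := by positivity
  have h5 : 0 ≤ B^4 * r^2 := by positivity
  nlinarith

lemma pair_integrable (ρ σ : R3 → ℝ) (hρ : ∀ x, 0 ≤ ρ x) (hσ : ∀ x, 0 ≤ σ x)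
    (iρ : Integrable ρ) (iσ : Integrable σ)
    (jρ : Integrable (fun x => (ρ x ^ (1/3:ℝ)) ^ 4))
    (jσ : Integrable (fun x => (σ x ^ (1/3:ℝ)) ^ 4)) :
    Integrable (fun z : R3 × R3 => ρ z.1 * σ z.2 / ‖z.1 - z.2‖) (volume.prod volume) := by
  have b1 := iρ.mul_prod iσ
  have b2 := jρ.mul_prod jσ
  have b3 := jσ.convolution_integrand (ContinuousLinearMap.mul ℝ ℝ) (μ := volume) K2_integrable
  have b4 := (jρ.convolution_integrand (ContinuousLinearMap.mul ℝ ℝ) (μ := volume) K2_integrable).swap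
  refine (((b1.add b2).add b3).add b4).mono' ?_ ?_
  · have hk : AEStronglyMeasurable (fun z : R3 × R3 => ‖z.1 - z.2‖⁻¹) (volume.prod volume) :=
      (by fun_prop : Measurable (fun z : R3 × R3 => ‖z.1 - z.2‖⁻¹)).aestronglyMeasurable
    simp only [div_eq_mul_inv]
    exact b1.aestronglyMeasurable.mul hk
  · refine Eventually.of_forall fun z => ?_
    have ha := hρ z.1
    have hb := hσ z.2
    have hA : 0 ≤ ρ z.1 ^ (1/3:ℝ) := Real.rpow_nonneg ha _
    have hB : 0 ≤ σ z.2 ^ (1/3:ℝ) := Real.rpow_nonneg hb _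
    have ea := cube_root _ ha
    have eb := cube_root _ hb
    rw [Real.norm_of_nonneg (by positivity)]
    simp only [Pi.add_apply, Function.comp, ContinuousLinearMap.mul_apply', Prod.fst_swap,
      Prod.snd_swap, K2]
    rw [norm_sub_rev z.2 z.1]
    set n := ‖z.1 - z.2‖
    have hn : 0 ≤ n := norm_nonneg _
    have hab : 0 ≤ ρ z.1 * σ z.2 := mul_nonneg ha hb
    by_cases h : n ≤ 1
    · simp only [h, if_true]
      have := young_aux _ _ (n⁻¹) hA hB (by positivity)
      rw [ea, eb] at this
      rw [div_eq_mul_inv]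
      linarith
    · simp only [h, if_false, mul_zero, add_zero]
      have h' : 1 ≤ n := le_of_not_ge h
      have := div_le_self hab h'
      have : 0 ≤ (ρ z.1 ^ (1/3:ℝ)) ^ 4 * (σ z.2 ^ (1/3:ℝ)) ^ 4 := by positivity
      linarith

lemma phi_growth (Φ Φ' : ℝ → ℝ) (k k' : ℝ) (hΦ : IsPhi Φ Φ' k k') :
    ∃ C, 0 ≤ C ∧ ∀ s, 0 ≤ s → (s ^ (1/3:ℝ)) ^ 5 ≤ C * (Φ s + s) := by
  obtain ⟨C, hC, F, hF, h⟩ := hΦ.growth_large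
  have hk := hΦ.k_pos
  refine ⟨1 / C + max F 1, by positivity, fun s hs => ?_⟩
  have hΦs := hΦ.nonneg s hs
  have hm : (1:ℝ) ≤ max F 1 := le_max_right _ _
  have hc' : 0 < 1 / C := by positivity
  rcases le_total s (max F 1) with h1 | h1
  · have e : (s ^ (1/3:ℝ)) ^ 3 = s := cube_root s hs
    have h2 : s ^ (1/3:ℝ) ≤ (max F 1) ^ (1/3:ℝ) := Real.rpow_le_rpow hs h1 (by norm_num)
    have h3 : ((max F 1) ^ (1/3:ℝ)) ^ 3 = max F 1 := cube_root _ (by linarith)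
    have h4 : 1 ≤ (max F 1) ^ (1/3:ℝ) := Real.one_le_rpow hm (by norm_num)
    have h5 : (s ^ (1/3:ℝ)) ^ 2 ≤ max F 1 := by
      calc _ ≤ ((max F 1) ^ (1/3:ℝ)) ^ 2 := by gcongr
        _ ≤ ((max F 1) ^ (1/3:ℝ)) ^ 3 := pow_le_pow_right₀ h4 (by norm_num)
        _ = _ := h3
    have : (s ^ (1/3:ℝ)) ^ 5 = s * (s ^ (1/3:ℝ)) ^ 2 := by rw [← e]; rw [e]; nth_rewrite 2 [← e]; ring
    rw [this]
    have h6 : s * (s ^ (1/3:ℝ)) ^ 2 ≤ s * max F 1 := by gcongr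
    have h7 : 0 ≤ (1/C) * (Φ s + s) := by positivity
    have h8 : 0 ≤ max F 1 * Φ s := by positivity
    linarith
  · have hs1 : 1 ≤ s := hm.trans h1
    have h2 := h s ((le_max_left _ _).trans h1)
    have e : (s ^ (1/3:ℝ)) ^ 5 = s ^ (5/3:ℝ) := by
      rw [← Real.rpow_natCast, ← Real.rpow_mul hs]; norm_num
    have h3 : s ^ (5/3:ℝ) ≤ s ^ (1 + 1/k) := by
      apply Real.rpow_le_rpow_of_exponent_le hs1
      have : 2/3 ≤ 1/k := by
        rw [div_le_div_iff₀ (by norm_num) hk]; linarith [hΦ.k_lt]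
      linarith
    rw [e]
    have h4 : s ^ (1 + 1/k) ≤ (1/C) * Φ s := by
      rw [div_mul_eq_mul_div, one_mul, le_div_iff₀ hC]; linarith
    have h7 : 0 ≤ (1/C) * s := by positivity
    have h8 : 0 ≤ max F 1 * (Φ s + s) := by positivity
    linarith

lemma slice_aux (μ S w : ℝ) (hμ : 0 ≤ μ) (hS : 0 ≤ S) (hw : 0 ≤ w) :
    μ ^ 2 * S ^ 3 ≤ w ^ 2 * S ^ 3 + S ^ 5 + (if w ≤ μ then μ ^ 5 else 0) := by
  have h1 : 0 ≤ w ^ 2 * S ^ 3 := by positivity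
  have h2 : 0 ≤ S ^ 5 := by positivity
  split_ifs with h
  · rcases le_total S μ with h' | h'
    · have : μ ^ 2 * S ^ 3 ≤ μ ^ 2 * μ ^ 3 := by gcongr
      nlinarith
    · have : μ ^ 2 * S ^ 3 ≤ S ^ 2 * S ^ 3 := by gcongr
      have : 0 ≤ μ ^ 5 := by positivity
      nlinarith
  · have : μ ^ 2 * S ^ 3 ≤ w ^ 2 * S ^ 3 := by
      have := le_of_not_ge h
      gcongr
    linarith

lemma slice_bound (c : ℝ) (hc : c = (volume : Measure R3).real (Metric.ball 0 1))
    (g : R3 → ℝ) (hg : ∀ v, 0 ≤ g v) (ig : Integrable g)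
    (ik : Integrable (fun v => ‖v‖ ^ 2 * g v)) (i5 : Integrable (fun v => (g v ^ (1/3:ℝ)) ^ 5))
    (μ : ℝ) (hμ : 0 ≤ μ) :
    μ ^ 2 * ∫ v, g v ≤ (∫ v, (‖v‖ ^ 2 * g v + (g v ^ (1/3:ℝ)) ^ 5)) + c * μ ^ 8 := by
  have i0 : Integrable ((Metric.closedBall (0:R3) μ).indicator (fun _ => μ ^ 5)) := by
    rw [integrable_indicator_iff Metric.isClosed_closedBall.measurableSet]
    apply integrableOn_const
    · exact measure_closedBall_lt_top.ne
    · simp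
  have e0 : ∫ v, (Metric.closedBall (0:R3) μ).indicator (fun _ => μ ^ 5) v = c * μ ^ 8 := by
    rw [integral_indicator Metric.isClosed_closedBall.measurableSet, setIntegral_const,
      Measure.addHaar_real_closedBall _ _ hμ, ← hc]
    simp; ring
  have ia : Integrable (fun v => ‖v‖ ^ 2 * g v + (g v ^ (1/3:ℝ)) ^ 5) := ik.add i5
  rw [← e0, ← integral_const_mul, ← integral_add ia i0]
  refine integral_mono (ig.const_mul _) ((ik.add i5).add i0) fun v => ?_
  have := slice_aux μ (g v ^ (1/3:ℝ)) ‖v‖ hμ (Real.rpow_nonneg (hg v) _) (norm_nonneg _)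
  rw [cube_root _ (hg v)] at this
  simpa [indicator] using this

lemma sd_nonneg (f : R3 × R3 → ℝ) (hf : ∀ p, 0 ≤ f p) (x : R3) : 0 ≤ spatialDensity f x :=
  integral_nonneg fun v => hf (x, v)

lemma sd_integrable (f : R3 × R3 → ℝ) (hf : Integrable f) : Integrable (spatialDensity f) :=
  Integrable.integral_prod_left (μ := volume) (ν := volume) hf

lemma sd_integrable4 (Φ Φ' : ℝ → ℝ) (k k' : ℝ) (hΦ : IsPhi Φ Φ' k k') (M : ℝ)
    (f : R3 × R3 → ℝ) (hf : MemFM Φ M f) :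
    Integrable (fun x => (spatialDensity f x ^ (1/3:ℝ)) ^ 4) := by
  obtain ⟨C, hC, hg⟩ := phi_growth Φ Φ' k k' hΦ
  have i5 : Integrable (fun p => (f p ^ (1/3:ℝ)) ^ 5) := by
    refine ((hf.cas_int.add hf.integrable).const_mul C).mono' ?_ ?_
    · exact ((hf.integrable.aestronglyMeasurable.aemeasurable.pow_const _).pow_const
        _).aestronglyMeasurable
    · refine Eventually.of_forall fun p => ?_
      have := Real.rpow_nonneg (hf.nonneg p) (1/3)
      rw [Real.norm_of_nonneg (by positivity)]
      exact hg _ (hf.nonneg p)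
  have s1 := Integrable.prod_right_ae (μ := volume) (ν := volume) hf.integrable
  have s2 := Integrable.prod_right_ae (μ := volume) (ν := volume) hf.kin_int
  have s3 := Integrable.prod_right_ae (μ := volume) (ν := volume) i5
  have iA := Integrable.integral_prod_left (μ := volume) (ν := volume) (hf.kin_int.add i5)
  set c := (volume : Measure R3).real (Metric.ball 0 1) with hc
  have hc0 : 0 ≤ c := measureReal_nonneg
  set a : ℝ := 1 / (2 * (c + 1)) with ha
  have ha0 : 0 < a := by positivity
  have ha1 : a ≤ 1 := by
    rw [ha, div_le_one (by positivity)]; linarith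
  have hca : c * a ≤ 1/2 := by
    rw [ha, mul_one_div, div_le_iff₀ (by positivity)]; linarith
  refine (iA.const_mul (2 / a)).mono' ?_ ?_
  · exact (((sd_integrable f hf.integrable).aestronglyMeasurable.aemeasurable.pow_const _).pow_const
        _).aestronglyMeasurable
  · filter_upwards [s1, s2, s3] with x h1 h2 h3
    have hρ := sd_nonneg f hf.nonneg x
    have hR := Real.rpow_nonneg hρ (1/3)
    have e := cube_root _ hρ
    rw [Real.norm_of_nonneg (by positivity)]
    set R := spatialDensity f x ^ (1/3:ℝ)
    have hb := slice_bound c hc (fun v => f (x, v)) (fun v => hf.nonneg _) h1 h2 h3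
      (Real.sqrt (a * R)) (Real.sqrt_nonneg _)
    have hsq : Real.sqrt (a * R) ^ 2 = a * R := Real.sq_sqrt (by positivity)
    have h8 : Real.sqrt (a * R) ^ 8 = (a * R) ^ 4 := by
      calc _ = (Real.sqrt (a * R) ^ 2) ^ 4 := by ring
        _ = _ := by rw [hsq]
    rw [hsq, h8] at hb
    change a * R * spatialDensity f x ≤ _ at hb
    rw [← e] at hb
    simp only [Pi.add_apply]
    set A := ∫ v, (‖v‖ ^ 2 * f (x, v) + (f (x, v) ^ (1/3:ℝ)) ^ 5)
    rw [div_mul_eq_mul_div, le_div_iff₀ ha0]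
    have h9 : c * (a * R) ^ 4 ≤ 1/2 * (a * R ^ 4) := by
      have q1 : a ^ 3 ≤ 1 := pow_le_one₀ ha0.le ha1
      have q2 : c * (a * R) ^ 4 = (c * a) * (a ^ 3 * R ^ 4) := by ring
      have q3 : a ^ 3 ≤ a := by nlinarith [pow_le_one₀ ha0.le ha1 (n := 2)]
      rw [q2]
      gcongr
    nlinarith

/-- Coulomb pairing as an integral over the product space. -/
def Bp (ρ σ : R3 → ℝ) : ℝ :=
  ∫ z : R3 × R3, ρ z.1 * σ z.2 / ‖z.1 - z.2‖ ∂((volume : Measure R3).prod volume)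

lemma Bp_symm (ρ σ : R3 → ℝ) : Bp ρ σ = Bp σ ρ := by
  unfold Bp
  rw [← integral_prod_swap]
  congr 1
  funext z
  simp only [Prod.fst_swap, Prod.snd_swap]
  rw [norm_sub_rev, mul_comm]

lemma U0_pair (Φ Φ' : ℝ → ℝ) (k k' : ℝ) (hΦ : IsPhi Φ Φ' k k') (M : ℝ)
    (f f₀ : R3 × R3 → ℝ) (hf : MemFM Φ M f) (hf₀ : MemFM Φ M f₀) :
    Integrable (fun p : R3 × R3 => U0rho (spatialDensity f₀) p.1 * f p) ∧
    ∫ p : R3 × R3, U0rho (spatialDensity f₀) p.1 * f p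
      = - Bp (spatialDensity f) (spatialDensity f₀) := by
  have i0 := sd_integrable f₀ hf₀.integrable
  have hB := pair_integrable _ _ (sd_nonneg f hf.nonneg) (sd_nonneg f₀ hf₀.nonneg)
    (sd_integrable f hf.integrable) i0
    (sd_integrable4 Φ Φ' k k' hΦ M f hf) (sd_integrable4 Φ Φ' k k' hΦ M f₀ hf₀)
  have hU : AEStronglyMeasurable (U0rho (spatialDensity f₀)) volume := by
    have hk : AEStronglyMeasurable (fun z : R3 × R3 => ‖z.1 - z.2‖⁻¹) (volume.prod volume) :=
      (by fun_prop : Measurable (fun z : R3 × R3 => ‖z.1 - z.2‖⁻¹)).aestronglyMeasurable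
    have h2 : AEStronglyMeasurable (fun z : R3 × R3 => spatialDensity f₀ z.2)
      (volume.prod volume) := i0.aestronglyMeasurable.comp_snd
    have := (h2.mul hk).integral_prod_right'.neg
    exact this
  have s1 := Integrable.prod_right_ae (μ := volume) (ν := volume) hf.integrable
  have eq1 : ∀ x, ∫ y, spatialDensity f x * spatialDensity f₀ y / ‖x - y‖
      = - (U0rho (spatialDensity f₀) x * spatialDensity f x) := by
    intro x
    simp only [mul_div_assoc]
    rw [integral_const_mul, U0rho]; ring
  have hx : Integrable (fun x => - (U0rho (spatialDensity f₀) x * spatialDensity f x)) := by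
    have := hB.integral_prod_left
    simp only [eq1] at this
    exact this
  have hI : Integrable (fun p : R3 × R3 => U0rho (spatialDensity f₀) p.1 * f p)
      (volume.prod volume) := by
    have hm : AEStronglyMeasurable (fun p : R3 × R3 => U0rho (spatialDensity f₀) p.1 * f p)
      (volume.prod volume) := hU.comp_fst.mul hf.integrable.aestronglyMeasurable
    rw [integrable_prod_iff hm]
    refine ⟨?_, ?_⟩
    · filter_upwards [s1] with x h
      exact h.const_mul _
    · refine hx.norm.congr (Eventually.of_forall fun x => ?_)
      simp only [norm_neg, norm_mul]
      rw [integral_const_mul, Real.norm_of_nonneg (sd_nonneg f hf.nonneg x)]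
      congr 1
      refine integral_congr_ae (Eventually.of_forall fun v => ?_)
      exact (Real.norm_of_nonneg (hf.nonneg _)).symm
  refine ⟨hI, ?_⟩
  change ∫ p : R3 × R3, U0rho (spatialDensity f₀) p.1 * f p ∂(volume.prod volume) = _
  rw [integral_prod _ hI, Bp, integral_prod _ hB]
  simp only [eq1]
  rw [integral_neg, neg_neg]
  refine integral_congr_ae (Eventually.of_forall fun x => ?_)
  simp only [integral_const_mul]
  rfl

lemma Dpair_eq_Bp (ρ : R3 → ℝ) (h : Integrable
    (fun z : R3 × R3 => ρ z.1 * ρ z.2 / ‖z.1 - z.2‖) (volume.prod volume)) :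
    Dpair ρ = Bp ρ ρ := by
  rw [Bp, integral_prod _ h]; rfl

lemma Dpair_sub (ρ σ : R3 → ℝ)
    (h11 : Integrable (fun z : R3 × R3 => ρ z.1 * ρ z.2 / ‖z.1 - z.2‖) (volume.prod volume))
    (h12 : Integrable (fun z : R3 × R3 => ρ z.1 * σ z.2 / ‖z.1 - z.2‖) (volume.prod volume))
    (h21 : Integrable (fun z : R3 × R3 => σ z.1 * ρ z.2 / ‖z.1 - z.2‖) (volume.prod volume))
    (h22 : Integrable (fun z : R3 × R3 => σ z.1 * σ z.2 / ‖z.1 - z.2‖) (volume.prod volume)) :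
    Dpair (fun x => ρ x - σ x) = Bp ρ ρ - Bp ρ σ - Bp σ ρ + Bp σ σ := by
  have e : (fun z : R3 × R3 => (ρ z.1 - σ z.1) * (ρ z.2 - σ z.2) / ‖z.1 - z.2‖)
      = fun z => (ρ z.1 * ρ z.2 / ‖z.1 - z.2‖ - ρ z.1 * σ z.2 / ‖z.1 - z.2‖
        - σ z.1 * ρ z.2 / ‖z.1 - z.2‖ + σ z.1 * σ z.2 / ‖z.1 - z.2‖) := by
    funext z; ring
  have i12 : Integrable (fun z : R3 × R3 => ρ z.1 * ρ z.2 / ‖z.1 - z.2‖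
    - ρ z.1 * σ z.2 / ‖z.1 - z.2‖) (volume.prod volume) := h11.sub h12
  have i123 : Integrable (fun z : R3 × R3 => ρ z.1 * ρ z.2 / ‖z.1 - z.2‖
    - ρ z.1 * σ z.2 / ‖z.1 - z.2‖ - σ z.1 * ρ z.2 / ‖z.1 - z.2‖) (volume.prod volume) :=
    i12.sub h21
  rw [Dpair_eq_Bp]
  · unfold Bp
    rw [e, integral_add i123 h22, integral_sub i12 h21, integral_sub h11 h12]
  · rw [e]; exact i123.add h22

lemma phi_strict (Φ Φ' : ℝ → ℝ) (k k' : ℝ) (hΦ : IsPhi Φ Φ' k k') (s t : ℝ)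
    (hs : 0 ≤ s) (ht : 0 ≤ t) (hst : t ≠ s) : Φ' s * (t - s) < Φ t - Φ s := by
  rcases lt_or_gt_of_ne hst with h | h
  · have := hΦ.sconvex.slope_lt_of_hasDerivAt (x := t) (y := s) ht hs h (hΦ.hasDeriv s hs)
    rw [slope_def_field, div_lt_iff₀ (by linarith)] at this
    linarith
  · have := hΦ.sconvex.lt_slope_of_hasDerivAt (x := s) (y := t) hs ht h (hΦ.hasDeriv s hs)
    rw [slope_def_field, lt_div_iff₀ (by linarith)] at this
    linarith

/-- the expansion `H_C(f) - H_C(f₀) = d(f,f₀) - (1/2)D(ρ_f - ρ_{f₀})`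
with `d(f,f₀) ≥ ∫∫ [Φ'(f₀) + E - E₀](f - f₀) ≥ 0` and `d(f,f₀) = 0` iff `f = f₀` a.e. -/
theorem energyCasimir_expansion
    (Φ Φ' : ℝ → ℝ) (k k' : ℝ) (hΦ : IsPhi Φ Φ' k k') (M : ℝ) (hM : 0 < M)
    (f₀ : R3 × R3 → ℝ) (hf₀ : MemFM Φ M f₀)
    (hmin : ∀ g, MemFM Φ M g → HC Φ f₀ ≤ HC Φ g)
    (E₀ : ℝ)
    (hEL : ∀ᵐ p ∂(volume : Measure (R3 × R3)),
      (Epart f₀ p < E₀ → 0 < f₀ p ∧ Φ' (f₀ p) = E₀ - Epart f₀ p) ∧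
      (E₀ ≤ Epart f₀ p → f₀ p = 0)) :
    ∀ f, MemFM Φ M f →
      (HC Φ f - HC Φ f₀ =
        dVP Φ f₀ f - (1/2) * Dpair (fun x => spatialDensity f x - spatialDensity f₀ x)) ∧
      (∫ p, (Φ' (f₀ p) + Epart f₀ p - E₀) * (f p - f₀ p)) ≤ dVP Φ f₀ f ∧
      (0 ≤ ∫ p, (Φ' (f₀ p) + Epart f₀ p - E₀) * (f p - f₀ p)) ∧
      (dVP Φ f₀ f = 0 ↔ f =ᵐ[(volume : Measure (R3 × R3))] f₀) := by
  intro f hf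
  have hρ := sd_nonneg f hf.nonneg
  have hσ := sd_nonneg f₀ hf₀.nonneg
  have iρ := sd_integrable f hf.integrable
  have iσ := sd_integrable f₀ hf₀.integrable
  have jρ := sd_integrable4 Φ Φ' k k' hΦ M f hf
  have jσ := sd_integrable4 Φ Φ' k k' hΦ M f₀ hf₀
  have h11 := pair_integrable _ _ hρ hρ iρ iρ jρ jρ
  have h12 := pair_integrable _ _ hρ hσ iρ iσ jρ jσ
  have h21 := pair_integrable _ _ hσ hρ iσ iρ jσ jρ
  have h22 := pair_integrable _ _ hσ hσ iσ iσ jσ jσ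
  obtain ⟨u1, e1⟩ := U0_pair Φ Φ' k k' hΦ M f f₀ hf hf₀
  obtain ⟨u0, e0⟩ := U0_pair Φ Φ' k k' hΦ M f₀ f₀ hf₀ hf₀
  have key : ∀ g, MemFM Φ M g →
      Integrable (fun p : R3 × R3 => U0rho (spatialDensity f₀) p.1 * g p) →
      Integrable (fun p => Φ (g p) + Epart f₀ p * g p) ∧
      ∫ p, (Φ (g p) + Epart f₀ p * g p) = Casimir Φ g + Ekin g
        + ∫ p : R3 × R3, U0rho (spatialDensity f₀) p.1 * g p := by
    intro g hg hu
    have e : (fun p => Φ (g p) + Epart f₀ p * g p) = fun p : R3 × R3 =>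
        (Φ (g p) + (1/2) * (‖p.2‖ ^ 2 * g p)) + U0rho (spatialDensity f₀) p.1 * g p := by
      funext p; unfold Epart; ring
    have ia : Integrable (fun p : R3 × R3 => Φ (g p) + (1/2) * (‖p.2‖ ^ 2 * g p)) :=
      hg.cas_int.add (hg.kin_int.const_mul _)
    rw [e]
    refine ⟨ia.add hu, ?_⟩
    rw [integral_add ia hu, integral_add hg.cas_int (hg.kin_int.const_mul _), integral_const_mul]
    rfl
  obtain ⟨k1, q1⟩ := key f hf u1
  obtain ⟨k0, q0⟩ := key f₀ hf₀ u0
  have ed : (fun p => Φ (f p) - Φ (f₀ p) + Epart f₀ p * (f p - f₀ p))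
      = fun p => (Φ (f p) + Epart f₀ p * f p) - (Φ (f₀ p) + Epart f₀ p * f₀ p) := by
    funext p; ring
  have id : Integrable (fun p => Φ (f p) - Φ (f₀ p) + Epart f₀ p * (f p - f₀ p)) := by
    rw [ed]; exact k1.sub k0
  have hd : dVP Φ f₀ f = (∫ p, (Φ (f p) + Epart f₀ p * f p))
      - ∫ p, (Φ (f₀ p) + Epart f₀ p * f₀ p) := by
    unfold dVP; rw [ed, integral_sub k1 k0]
  have im : Integrable (fun p => E₀ * (f p - f₀ p)) :=
    (hf.integrable.sub hf₀.integrable).const_mul _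
  have em : ∫ p, E₀ * (f p - f₀ p) = 0 := by
    rw [integral_const_mul, integral_sub hf.integrable hf₀.integrable, hf.mass, hf₀.mass]; ring
  have ih : Integrable (fun p => Φ (f p) - Φ (f₀ p) + Epart f₀ p * (f p - f₀ p)
      - E₀ * (f p - f₀ p)) := id.sub im
  have hh : ∫ p, (Φ (f p) - Φ (f₀ p) + Epart f₀ p * (f p - f₀ p)
      - E₀ * (f p - f₀ p)) = dVP Φ f₀ f := by
    rw [integral_sub id im, em, sub_zero]; rfl
  have pos : 0 ≤ᵐ[(volume : Measure (R3 × R3))]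
      fun p => (Φ' (f₀ p) + Epart f₀ p - E₀) * (f p - f₀ p) := by
    filter_upwards [hEL] with p hp
    rcases lt_or_ge (Epart f₀ p) E₀ with h | h
    · have := (hp.1 h).2
      simp [this]
    · have h0 := hp.2 h
      have := hf.nonneg p
      simp only [Pi.zero_apply, h0, hΦ.deriv_zero, zero_add, sub_zero]
      exact mul_nonneg (by linarith) this
  have le : ∀ p, (Φ' (f₀ p) + Epart f₀ p - E₀) * (f p - f₀ p) ≤
      Φ (f p) - Φ (f₀ p) + Epart f₀ p * (f p - f₀ p) - E₀ * (f p - f₀ p) := by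
    intro p
    by_cases h : f p = f₀ p
    · simp [h]
    · have := phi_strict Φ Φ' k k' hΦ (f₀ p) (f p) (hf₀.nonneg p) (hf.nonneg p) h
      linarith
  refine ⟨?_, ?_, integral_nonneg_of_ae pos, ?_, ?_⟩
  · rw [hd, q1, q0, e1, e0, Dpair_sub _ _ h11 h12 h21 h22, Bp_symm (spatialDensity f₀)
      (spatialDensity f)]
    unfold HC Epot
    rw [Dpair_eq_Bp _ h11, Dpair_eq_Bp _ h22]
    ring
  · rw [← hh]
    exact integral_mono_of_nonneg pos ih (Eventually.of_forall le)
  · intro h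
    rw [← hh, integral_eq_zero_iff_of_nonneg_ae] at h
    · filter_upwards [h, pos] with p hp hq
      by_contra hne
      have := phi_strict Φ Φ' k k' hΦ (f₀ p) (f p) (hf₀.nonneg p) (hf.nonneg p) hne
      simp only [Pi.zero_apply] at hp hq
      linarith
    · filter_upwards [pos] with p hp
      exact hp.trans (le p)
    · exact ih
  · intro h
    unfold dVP
    rw [integral_eq_zero_of_ae]
    filter_upwards [h] with p hp
    simp [hp]
end
end

section
/- Define Ψ(s) := inf{ ∫_{ℝ³} ((1/2)|v|² g(v) + Φ(g(v))) dv : g ∈ L¹₊(ℝ³), ∫ g dv = s } for s ≥ 0, and the reduced functional H_r(ρ) := ∫ Ψ(ρ(x)) dx + E_pot(ρ). Then for every f ∈ F_M the estimate H_C(f) ≥ H_r(ρ_f) holds, with equality if f = f₀ is a minimizer of H_C on F_M. -/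
open MeasureTheory Filter Topology Set ENNReal

noncomputable section

/-- A continuous function on the line that agrees with `Φ` on nonnegative numbers. -/
lemma phi_cont_ext {Φ Φ' : ℝ → ℝ} {k k' : ℝ} (hΦ : IsPhi Φ Φ' k k') :
    ∃ T : ℝ → ℝ, Continuous T ∧ ∀ s, 0 ≤ s → T s = Φ s := by
  refine ⟨fun s => Φ (max s 0), ?_, fun s hs => by simp [max_eq_left hs]⟩
  have h : ContinuousOn Φ (Ici 0) := fun s hs => (hΦ.hasDeriv s hs).continuousAt.continuousWithinAt
  exact h.comp_continuous (by fun_prop) (fun s => mem_Ici.2 (le_max_right _ _))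

lemma phi_scale {Φ Φ' : ℝ → ℝ} {k k' : ℝ} (hΦ : IsPhi Φ Φ' k k') {t s : ℝ}
    (ht : 0 ≤ t) (ht1 : t ≤ 1) (hs : 0 ≤ s) : Φ (t * s) ≤ t * Φ s := by
  have h := hΦ.sconvex.convexOn.2 (x := s) (y := 0) hs (by simp) ht (sub_nonneg.2 ht1) (by ring)
  simpa [hΦ.zero] using h

/-- Velocity-space energy density. -/
def Jd (Φ : ℝ → ℝ) (g : R3 → ℝ) (v : R3) : ℝ := (1/2) * ‖v‖ ^ 2 * g v + Φ (g v)

lemma Jd_nonneg {Φ Φ' : ℝ → ℝ} {k k' : ℝ} (hΦ : IsPhi Φ Φ' k k') {g : R3 → ℝ}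
    (hg : ∀ v, 0 ≤ g v) (v : R3) : 0 ≤ Jd Φ g v := by
  have := hΦ.nonneg _ (hg v)
  have := hg v
  unfold Jd; positivity

/-- Admissible measurable profile of mass `s`. -/
structure Adm (Φ : ℝ → ℝ) (s : ℝ) (g : R3 → ℝ) : Prop where
  nonneg : ∀ v, 0 ≤ g v
  int : Integrable g
  mass : (∫ v, g v) = s
  jint : Integrable (Jd Φ g)

lemma PsiOf_le {Φ Φ' : ℝ → ℝ} {k k' : ℝ} (hΦ : IsPhi Φ Φ' k k') {s : ℝ} {g : R3 → ℝ}
    (h : Adm Φ s g) : PsiOf Φ s ≤ ∫ v, Jd Φ g v := by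
  apply csInf_le
  · refine ⟨0, ?_⟩
    rintro r ⟨g, hg, -, -, -, rfl⟩
    exact integral_nonneg (fun v => Jd_nonneg hΦ hg v)
  · exact ⟨g, h.nonneg, h.int, h.mass, h.jint, rfl⟩

lemma PsiOf_nonneg {Φ Φ' : ℝ → ℝ} {k k' : ℝ} (hΦ : IsPhi Φ Φ' k k') (s : ℝ) :
    0 ≤ PsiOf Φ s := by
  apply Real.sInf_nonneg
  rintro r ⟨g, hg, -, -, -, rfl⟩
  exact integral_nonneg (fun v => Jd_nonneg hΦ hg v)

lemma exists_adm {Φ Φ' : ℝ → ℝ} {k k' : ℝ} (hΦ : IsPhi Φ Φ' k k') {s : ℝ} (hs : 0 ≤ s) :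
    ∃ g, Adm Φ s g := by
  set B : Set R3 := Metric.ball 0 1
  have hB : MeasurableSet B := measurableSet_ball
  have hfin : volume B ≠ ∞ := measure_ball_lt_top.ne
  have hpos : 0 < volume.real B :=
    ENNReal.toReal_pos (Metric.measure_ball_pos volume 0 one_pos).ne' hfin
  set c : ℝ := s / volume.real B
  have hc : 0 ≤ c := by positivity
  refine ⟨B.indicator fun _ => c, fun v => indicator_nonneg (fun _ _ => hc) v, ?_, ?_, ?_⟩
  · exact (integrable_indicator_iff hB).2 (integrableOn_const hfin)
  · rw [integral_indicator_const _ hB, smul_eq_mul]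
    field_simp [c]
    simp only [c]
    field_simp
  · have : Jd Φ (B.indicator fun _ => c) = B.indicator fun v => (1/2) * ‖v‖ ^ 2 * c + Φ c := by
      funext v
      by_cases hv : v ∈ B <;> simp [Jd, hv, hΦ.zero]
    rw [this, integrable_indicator_iff hB]
    have hcont : Continuous fun v : R3 => (1/2) * ‖v‖ ^ 2 * c + Φ c := by fun_prop
    exact (hcont.continuousOn.integrableOn_compact (isCompact_closedBall (0:R3) 1)).mono_set
      Metric.ball_subset_closedBall

lemma exists_near {Φ Φ' : ℝ → ℝ} {k k' : ℝ} (hΦ : IsPhi Φ Φ' k k') {s : ℝ} (hs : 0 ≤ s)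
    {δ : ℝ} (hδ : 0 < δ) :
    ∃ g, Measurable g ∧ Adm Φ s g ∧ ∫ v, Jd Φ g v ≤ PsiOf Φ s + δ := by
  obtain ⟨g0, h0⟩ := exists_adm hΦ hs
  obtain ⟨r, ⟨g, hg, hgi, hgm, hgj, rfl⟩, hr⟩ := Real.lt_sInf_add_pos
    (s := { r : ℝ | ∃ g : R3 → ℝ, (∀ v, 0 ≤ g v) ∧ Integrable g ∧ (∫ v, g v) = s ∧
    Integrable (fun v => (1/2) * ‖v‖ ^ 2 * g v + Φ (g v)) ∧
    r = ∫ v, ((1/2) * ‖v‖ ^ 2 * g v + Φ (g v)) })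
    ⟨_, g0, h0.nonneg, h0.int, h0.mass, h0.jint, rfl⟩ hδ
  set g' : R3 → ℝ := fun v => max (hgi.1.mk g v) 0
  have hae : g =ᵐ[volume] g' := by
    filter_upwards [hgi.1.ae_eq_mk] with v hv
    simp only [g']
    rw [← hv, max_eq_left (hg v)]
  have hJ : (fun v => (1/2) * ‖v‖ ^ 2 * g v + Φ (g v)) =ᵐ[volume] Jd Φ g' := by
    filter_upwards [hae] with v hv
    simp only [Jd]
    rw [hv]
  refine ⟨g', hgi.1.stronglyMeasurable_mk.measurable.max measurable_const,
    ⟨fun v => le_max_right _ _, hgi.congr hae, ?_, hgj.congr hJ⟩, ?_⟩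
  · rw [← integral_congr_ae hae, hgm]
  · rw [← integral_congr_ae hJ]
    exact hr.le

lemma adm_scale {Φ Φ' : ℝ → ℝ} {k k' : ℝ} (hΦ : IsPhi Φ Φ' k k') {q t : ℝ} {g : R3 → ℝ}
    (hg : Adm Φ q g) (ht : 0 ≤ t) (ht1 : t ≤ 1) :
    Adm Φ (t * q) (fun v => t * g v) ∧ ∫ v, Jd Φ (fun v => t * g v) v ≤ t * ∫ v, Jd Φ g v := by
  have hn : ∀ v, 0 ≤ t * g v := fun v => mul_nonneg ht (hg.nonneg v)
  have hle : ∀ v, Jd Φ (fun v => t * g v) v ≤ t * Jd Φ g v := by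
    intro v
    have := phi_scale hΦ ht ht1 (hg.nonneg v)
    simp only [Jd]
    nlinarith
  have hm : AEStronglyMeasurable (Jd Φ (fun v => t * g v)) := by
    obtain ⟨T, hT, hTe⟩ := phi_cont_ext hΦ
    have : Jd Φ (fun v => t * g v) = fun v => (1/2) * ‖v‖ ^ 2 * (t * g v) + T (t * g v) := by
      funext v
      simp only [Jd]
      rw [hTe _ (hn v)]
    rw [this]
    have h1 : AEStronglyMeasurable (fun v => t * g v) := hg.int.1.const_mul t
    have h2 : Continuous fun v : R3 => (1/2) * ‖v‖ ^ 2 := by fun_prop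
    exact (h2.aestronglyMeasurable.mul h1).add (hT.comp_aestronglyMeasurable h1)
  have hi : Integrable (Jd Φ (fun v => t * g v)) := by
    refine (hg.jint.const_mul t).mono' hm (ae_of_all _ fun v => ?_)
    rw [Real.norm_of_nonneg (Jd_nonneg hΦ hn v)]
    exact hle v
  refine ⟨⟨hn, hg.int.const_mul t, ?_, hi⟩, ?_⟩
  · rw [integral_const_mul, hg.mass]
  · rw [← integral_const_mul]
    exact integral_mono hi (hg.jint.const_mul t) hle

lemma PsiOf_mono {Φ Φ' : ℝ → ℝ} {k k' : ℝ} (hΦ : IsPhi Φ Φ' k k') :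
    Monotone (fun s => PsiOf Φ (max s 0)) := by
  have key : ∀ a b : ℝ, 0 ≤ a → a ≤ b → PsiOf Φ a ≤ PsiOf Φ b := by
    intro a b ha hab
    rcases eq_or_lt_of_le hab with rfl | hlt
    · exact le_rfl
    have hb : 0 < b := ha.trans_lt hlt
    refine le_of_forall_pos_le_add fun δ hδ => ?_
    obtain ⟨g, -, hg, hgJ⟩ := exists_near hΦ hb.le hδ
    have ht : 0 ≤ a / b := by positivity
    have ht1 : a / b ≤ 1 := (div_le_one hb).2 hab
    obtain ⟨h1, h2⟩ := adm_scale hΦ hg ht ht1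
    rw [div_mul_cancel₀ _ hb.ne'] at h1
    have h3 := PsiOf_le hΦ h1
    have h4 : 0 ≤ ∫ v, Jd Φ g v := integral_nonneg (Jd_nonneg hΦ hg.nonneg)
    nlinarith
  intro a b hab
  exact key _ _ (le_max_right _ _) (max_le_max_right _ hab)

lemma exists_family {Φ Φ' : ℝ → ℝ} {k k' : ℝ} (hΦ : IsPhi Φ Φ' k k') {ε : ℝ} (hε : 0 < ε) :
    ∃ (q : ℕ → ℝ) (G : ℕ → R3 → ℝ), (∀ n, 0 < q n) ∧ (∀ n, Measurable (G n)) ∧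
      (∀ n, Adm Φ (q n) (G n)) ∧
      ∀ s, 0 ≤ s → ∃ n, s ≤ q n ∧ s / q n * (∫ v, Jd Φ (G n) v) ≤ PsiOf Φ s + ε * s := by
  set P : ℝ → ℝ := fun s => PsiOf Φ (max s 0) with hP
  have hPe : ∀ s, 0 ≤ s → P s = PsiOf Φ s := fun s hs => by simp [hP, max_eq_left hs]
  set D : Set ℝ := ({x | ¬ ContinuousAt P x} ∪ range ((↑) : ℚ → ℝ)) ∩ Ioi 0
  have hD : D.Countable :=
    ((PsiOf_mono hΦ).countable_not_continuousAt.union (countable_range _)).mono inter_subset_left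
  have hDn : D.Nonempty := ⟨1, Or.inr ⟨1, by simp⟩, by simp⟩
  obtain ⟨q, hq⟩ := hD.exists_eq_range hDn
  have hqpos : ∀ n, 0 < q n := fun n => by
    have : q n ∈ D := hq ▸ mem_range_self n
    exact this.2
  choose G hGm hGa hGJ using fun n => exists_near hΦ (hqpos n).le
    (δ := ε / 2 * q n) (by have := hqpos n; positivity)
  refine ⟨q, G, hqpos, hGm, hGa, fun s hs => ?_⟩
  have hΨ := PsiOf_nonneg hΦ s
  rcases hs.eq_or_lt with rfl | hs
  · exact ⟨0, (hqpos 0).le, by simpa using hΨ⟩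
  suffices ∃ n, s ≤ q n ∧ PsiOf Φ (q n) ≤ PsiOf Φ s + ε / 2 * s by
    obtain ⟨n, hn, hn2⟩ := this
    refine ⟨n, hn, ?_⟩
    have hq0 := hqpos n
    have h1 : s / q n ≤ 1 := (div_le_one hq0).2 hn
    have h2 : 0 ≤ s / q n := by positivity
    have h3 : 0 ≤ PsiOf Φ (q n) := PsiOf_nonneg hΦ _
    calc s / q n * (∫ v, Jd Φ (G n) v) ≤ s / q n * (PsiOf Φ (q n) + ε / 2 * q n) := by
          gcongr; exact hGJ n
      _ = s / q n * PsiOf Φ (q n) + ε / 2 * s := by field_simp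
      _ ≤ 1 * PsiOf Φ (q n) + ε / 2 * s := by gcongr
      _ ≤ PsiOf Φ s + ε * s := by linarith
  by_cases hc : ContinuousAt P s
  · have hlt : P s < PsiOf Φ s + ε / 2 * s := by
      rw [hPe s hs.le]; have : 0 < ε / 2 * s := by positivity
      linarith
    have hev := hc.eventually_lt_const hlt
    obtain ⟨u, hu, hu2⟩ := Metric.eventually_nhds_iff.1 hev
    obtain ⟨r, hr1, hr2⟩ := exists_rat_btwn (show s < s + u by linarith)
    have hrD : (r : ℝ) ∈ D := ⟨Or.inr ⟨r, rfl⟩, hs.trans hr1⟩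
    rw [hq] at hrD
    obtain ⟨n, hn⟩ := hrD
    refine ⟨n, by rw [hn]; exact hr1.le, ?_⟩
    have := hu2 (y := (r : ℝ)) (by rw [Real.dist_eq, abs_of_pos] <;> linarith)
    rw [hPe _ (hs.trans hr1).le] at this
    rw [hn]; exact this.le
  · have : s ∈ D := ⟨Or.inl hc, hs⟩
    rw [hq] at this
    obtain ⟨n, rfl⟩ := this
    have := hqpos n
    exact ⟨n, le_rfl, by have : 0 < ε / 2 * q n := by positivity
                         linarith⟩

lemma fm_energy {Φ : ℝ → ℝ} {M : ℝ} {f : R3 × R3 → ℝ} (hf : MemFM Φ M f) :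
    Integrable (fun p : R3 × R3 => Jd Φ (fun v => f (p.1, v)) p.2) ∧
    Ekin f + Casimir Φ f = ∫ x, ∫ v, Jd Φ (fun v => f (x, v)) v := by
  have h1 : Integrable (fun p : R3 × R3 => (1/2) * (‖p.2‖ ^ 2 * f p)) := hf.kin_int.const_mul _
  have he : (fun p : R3 × R3 => Jd Φ (fun v => f (p.1, v)) p.2) =
      fun p => (1/2) * (‖p.2‖ ^ 2 * f p) + Φ (f p) := by
    funext p
    simp only [Jd]
    ring
  have hi : Integrable (fun p : R3 × R3 => Jd Φ (fun v => f (p.1, v)) p.2) := by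
    rw [he]; exact h1.add hf.cas_int
  refine ⟨hi, ?_⟩
  have h2 := integral_prod (μ := volume) (ν := volume) _ hi
  simp only at h2
  rw [← h2]
  change _ = ∫ p : R3 × R3, Jd Φ (fun v => f (p.1, v)) p.2
  rw [he, integral_add h1 hf.cas_int, integral_const_mul]
  rfl

lemma fm_adm {Φ : ℝ → ℝ} {M : ℝ} {f : R3 × R3 → ℝ} (hf : MemFM Φ M f) :
    ∀ᵐ x : R3, Adm Φ (spatialDensity f x) (fun v => f (x, v)) := by
  have h1 := Integrable.prod_right_ae (μ := (volume : Measure R3)) (ν := (volume : Measure R3))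
    hf.integrable
  have h2 := Integrable.prod_right_ae (μ := (volume : Measure R3)) (ν := (volume : Measure R3))
    (fm_energy hf).1
  filter_upwards [h1, h2] with x hx hx2
  exact ⟨fun v => hf.nonneg _, hx, rfl, hx2⟩

lemma Epot_congr {a b : R3 → ℝ} (h : a =ᵐ[volume] b) : Epot a = Epot b := by
  unfold Epot Dpair
  congr 1
  apply integral_congr_ae
  filter_upwards [h] with x hx
  apply integral_congr_ae
  filter_upwards [h] with y hy
  simp only [hx, hy]

lemma psi_le {Φ Φ' : ℝ → ℝ} {k k' : ℝ} (hΦ : IsPhi Φ Φ' k k') {M : ℝ} {f : R3 × R3 → ℝ}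
    (hf : MemFM Φ M f) :
    ∀ᵐ x : R3, PsiOf Φ (spatialDensity f x) ≤ ∫ v, Jd Φ (fun v => f (x, v)) v := by
  filter_upwards [fm_adm hf] with x hx
  exact PsiOf_le hΦ hx

lemma fm_jint {Φ : ℝ → ℝ} {M : ℝ} {f : R3 × R3 → ℝ}
    (hf : MemFM Φ M f) : Integrable (fun x => ∫ v, Jd Φ (fun v => f (x, v)) v) :=
  Integrable.integral_prod_left (μ := (volume : Measure R3)) (ν := (volume : Measure R3))
    (fm_energy hf).1

lemma lower_bound {Φ Φ' : ℝ → ℝ} {k k' : ℝ} (hΦ : IsPhi Φ Φ' k k') {M : ℝ} {f : R3 × R3 → ℝ}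
    (hf : MemFM Φ M f) : Hr (PsiOf Φ) (spatialDensity f) ≤ HC Φ f := by
  have h : ∫ x, PsiOf Φ (spatialDensity f x) ≤ Ekin f + Casimir Φ f := by
    rw [(fm_energy hf).2]
    exact integral_mono_of_nonneg (ae_of_all _ fun x => PsiOf_nonneg hΦ _) (fm_jint hf)
      (psi_le hΦ hf)
  unfold Hr HC
  linarith

/-- A competitor with the same spatial density and almost optimal velocity profiles. -/
lemma exists_competitor {Φ Φ' : ℝ → ℝ} {k k' : ℝ} (hΦ : IsPhi Φ Φ' k k') {M : ℝ}
    {ρ : R3 → ℝ} (hρm : Measurable ρ) (hρ0 : ∀ x, 0 ≤ ρ x) (hρi : Integrable ρ)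
    (hρM : ∫ x, ρ x = M) (hΨ : Integrable (fun x => PsiOf Φ (ρ x))) {ε : ℝ} (hε : 0 < ε) :
    ∃ g, MemFM Φ M g ∧ spatialDensity g = ρ ∧
      Ekin g + Casimir Φ g ≤ (∫ x, PsiOf Φ (ρ x)) + ε * M := by
  classical
  obtain ⟨q, G, hq, hGm, hGa, hcov⟩ := exists_family hΦ hε
  have hex : ∀ x, ∃ n, ρ x ≤ q n ∧
      ρ x / q n * (∫ v, Jd Φ (G n) v) ≤ PsiOf Φ (ρ x) + ε * ρ x := fun x => hcov _ (hρ0 x)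
  have hΨm : Measurable fun x => PsiOf Φ (ρ x) := by
    have := (PsiOf_mono hΦ).measurable.comp hρm
    convert this using 2 with x
    simp [max_eq_left (hρ0 x)]
  set N : R3 → ℕ := fun x => Nat.find (hex x) with hN
  have hNm : Measurable N := by
    refine measurable_find hex fun n => ?_
    exact (measurableSet_le hρm measurable_const).inter
      (measurableSet_le ((hρm.div_const _).mul_const _) (hΨm.add (hρm.const_mul _)))
  have hNs : ∀ x, ρ x ≤ q (N x) ∧
      ρ x / q (N x) * (∫ v, Jd Φ (G (N x)) v) ≤ PsiOf Φ (ρ x) + ε * ρ x :=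
    fun x => Nat.find_spec (hex x)
  have hqm : Measurable fun x => q (N x) := (measurable_of_countable q).comp hNm
  have hGu : Measurable fun p : ℕ × R3 => G p.1 p.2 :=
    measurable_from_prod_countable_right hGm
  set g : R3 × R3 → ℝ := fun p => ρ p.1 / q (N p.1) * G (N p.1) p.2 with hg
  have hgm : Measurable g := by
    have h1 : Measurable fun p : R3 × R3 => G (N p.1) p.2 :=
      hGu.comp ((hNm.comp measurable_fst).prodMk measurable_snd)
    exact ((hρm.div hqm).comp measurable_fst).mul h1
  have hsl : ∀ x, Adm Φ (ρ x) (fun v => g (x, v)) ∧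
      ∫ v, Jd Φ (fun v => g (x, v)) v ≤ PsiOf Φ (ρ x) + ε * ρ x := by
    intro x
    have hq0 := hq (N x)
    obtain ⟨h1, h2⟩ := adm_scale hΦ (hGa (N x)) (div_nonneg (hρ0 x) hq0.le)
      ((div_le_one hq0).2 (hNs x).1)
    rw [div_mul_cancel₀ _ hq0.ne'] at h1
    exact ⟨h1, h2.trans (hNs x).2⟩
  have hg0 : ∀ p, 0 ≤ g p := fun p => (hsl p.1).1.nonneg p.2
  have hsd : spatialDensity g = ρ := funext fun x => (hsl x).1.mass
  have hgi : Integrable g := by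
    refine (integrable_prod_iff (μ := volume) (ν := volume) hgm.aestronglyMeasurable).2
      ⟨ae_of_all _ fun x => (hsl x).1.int, ?_⟩
    refine hρi.congr (ae_of_all _ fun x => ?_)
    simp only [Real.norm_of_nonneg (hg0 _)]
    exact (hsl x).1.mass.symm
  obtain ⟨T, hT, hTe⟩ := phi_cont_ext hΦ
  have hΦm : Measurable fun p => Φ (g p) := by
    have : (fun p => Φ (g p)) = fun p => T (g p) := funext fun p => (hTe _ (hg0 p)).symm
    rw [this]
    exact hT.measurable.comp hgm
  have hkm : Measurable fun p : R3 × R3 => ‖p.2‖ ^ 2 * g p := by fun_prop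
  have hJm : Measurable fun p : R3 × R3 => Jd Φ (fun v => g (p.1, v)) p.2 := by
    have : (fun p : R3 × R3 => Jd Φ (fun v => g (p.1, v)) p.2) =
        fun p => (1/2) * (‖p.2‖ ^ 2 * g p) + Φ (g p) := by
      funext p
      simp only [Jd]
      ring
    rw [this]
    exact (hkm.const_mul _).add hΦm
  have hJ0 : ∀ x v, 0 ≤ Jd Φ (fun v => g (x, v)) v :=
    fun x v => Jd_nonneg hΦ (fun v => hg0 _) v
  have hbd : Integrable fun x => PsiOf Φ (ρ x) + ε * ρ x := hΨ.add (hρi.const_mul ε)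
  have hJi : Integrable fun p : R3 × R3 => Jd Φ (fun v => g (p.1, v)) p.2 := by
    refine (integrable_prod_iff (μ := volume) (ν := volume) hJm.aestronglyMeasurable).2
      ⟨ae_of_all _ fun x => (hsl x).1.jint, ?_⟩
    refine hbd.mono' hJm.aestronglyMeasurable.norm.integral_prod_right' (ae_of_all _ fun x => ?_)
    simp only [Real.norm_of_nonneg (hJ0 x _)]
    rw [Real.norm_of_nonneg (integral_nonneg (hJ0 x))]
    exact (hsl x).2
  have hmem : MemFM Φ M g := by
    refine ⟨hg0, hgi, ?_, ?_, ?_⟩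
    · have := integral_prod (μ := (volume : Measure R3)) (ν := (volume : Measure R3)) _ hgi
      refine this.trans ?_
      rw [← hρM]
      exact integral_congr_ae (ae_of_all _ fun x => (hsl x).1.mass)
    · refine (hJi.const_mul 2).mono' hkm.aestronglyMeasurable (ae_of_all _ fun p => ?_)
      have h1 := hg0 p
      have h2 := hΦ.nonneg _ h1
      rw [Real.norm_of_nonneg (by positivity)]
      simp only [Jd]
      nlinarith
    · refine hJi.mono' hΦm.aestronglyMeasurable (ae_of_all _ fun p => ?_)
      have h1 := hg0 p
      have h2 := hΦ.nonneg _ h1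
      rw [Real.norm_of_nonneg h2]
      simp only [Jd]
      have : 0 ≤ 1 / 2 * ‖p.2‖ ^ 2 * g (p.1, p.2) := by positivity
      linarith
  refine ⟨g, hmem, hsd, ?_⟩
  rw [(fm_energy hmem).2]
  calc _ ≤ ∫ x, (PsiOf Φ (ρ x) + ε * ρ x) :=
        integral_mono (fm_jint hmem) hbd fun x => (hsl x).2
    _ = _ := by rw [integral_add hΨ (hρi.const_mul ε), integral_const_mul, hρM]

/-- `H_C(f) ≥ H_r(ρ_f)` for all `f ∈ F_M`, with equality if `f`
minimizes `H_C` on `F_M`. -/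
theorem reduction_estimate
    (Φ Φ' : ℝ → ℝ) (k k' : ℝ) (hΦ : IsPhi Φ Φ' k k') (M : ℝ) (hM : 0 < M) :
    (∀ f, MemFM Φ M f → Hr (PsiOf Φ) (spatialDensity f) ≤ HC Φ f) ∧
    (∀ f₀, MemFM Φ M f₀ → (∀ g, MemFM Φ M g → HC Φ f₀ ≤ HC Φ g) →
      Hr (PsiOf Φ) (spatialDensity f₀) = HC Φ f₀) := by
  refine ⟨fun f hf => lower_bound hΦ hf, fun f hf hmin => ?_⟩
  refine le_antisymm (lower_bound hΦ hf) ?_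
  have hri : Integrable (spatialDensity f) :=
    Integrable.integral_prod_left (μ := (volume : Measure R3)) (ν := (volume : Measure R3))
      hf.integrable
  have hr0 : ∀ x, 0 ≤ spatialDensity f x := fun x => integral_nonneg fun v => hf.nonneg _
  set ρ : R3 → ℝ := fun x => max (hri.1.mk _ x) 0 with hρ
  have hρm : Measurable ρ := hri.1.stronglyMeasurable_mk.measurable.max measurable_const
  have hρ0 : ∀ x, 0 ≤ ρ x := fun x => le_max_right _ _
  have hae : spatialDensity f =ᵐ[volume] ρ := by
    filter_upwards [hri.1.ae_eq_mk] with x hx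
    simp only [hρ]
    rw [← hx, max_eq_left (hr0 x)]
  have hρi : Integrable ρ := hri.congr hae
  have hρM : ∫ x, ρ x = M := by
    rw [← integral_congr_ae hae, ← hf.mass]
    exact (integral_prod (μ := (volume : Measure R3)) (ν := (volume : Measure R3)) _
      hf.integrable).symm
  have hΨm : Measurable fun x => PsiOf Φ (ρ x) := by
    have := (PsiOf_mono hΦ).measurable.comp hρm
    convert this using 2 with x
    simp [max_eq_left (hρ0 x)]
  have hΨ : Integrable (fun x => PsiOf Φ (ρ x)) := by
    refine (fm_jint hf).mono' hΨm.aestronglyMeasurable ?_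
    filter_upwards [psi_le hΦ hf, hae] with x h1 h2
    rw [Real.norm_of_nonneg (PsiOf_nonneg hΦ _), ← h2]
    exact h1
  have hHr : Hr (PsiOf Φ) (spatialDensity f) = (∫ x, PsiOf Φ (ρ x)) + Epot ρ := by
    unfold Hr
    rw [Epot_congr hae]
    congr 1
    apply integral_congr_ae
    filter_upwards [hae] with x hx
    rw [hx]
  refine le_of_forall_pos_le_add fun δ hδ => ?_
  obtain ⟨g, hg, hgρ, hgE⟩ := exists_competitor hΦ hρm hρ0 hρi hρM hΨ (div_pos hδ hM)
  have h := hmin g hg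
  rw [div_mul_cancel₀ _ hM.ne'] at hgE
  have h2 : HC Φ g = Ekin g + Epot ρ + Casimir Φ g := by rw [HC, hgρ]
  rw [hHr]
  linarith
end
end
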